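/- (Decay estimate, Proposition 2.3) For every dimension n ≥ 1 there exist constants ε₂ > 0 and C > 0 with the following property: let T ≥ 3 and let f : ℝ² → ℝⁿ be smooth, 2π-periodic in θ, weakly conformal, with Δf = 0 at every point where ∇f = 0. If for some ε with 0 < ε ≤ ε₂ one has sup_{s ∈ [−T, T−1]} W(f, [s,s+1]×[0,2π]) < ε², then for every t ∈ [0, T], ∫_{[−t,t]×[0,2π]} |∇f|² ≤ C e^{−(1−Cε)(T−t)} ∫_{[−T,T]×[0,2π]} |∇f|². -/

import Mathlib

open MeasureTheory Set Filter
open scoped ENNReal Real RealInnerProductSpace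

/-- Partial derivative in the first coordinate direction. -/
noncomputable def pd1 {n : ℕ} (f : ℝ × ℝ → EuclideanSpace ℝ (Fin n)) (z : ℝ × ℝ) :
    EuclideanSpace ℝ (Fin n) := fderiv ℝ f z (1, 0)

/-- Partial derivative in the second coordinate direction. -/
noncomputable def pd2 {n : ℕ} (f : ℝ × ℝ → EuclideanSpace ℝ (Fin n)) (z : ℝ × ℝ) :
    EuclideanSpace ℝ (Fin n) := fderiv ℝ f z (0, 1)

/-- `|∇f|²`. -/
noncomputable def gradSq {n : ℕ} (f : ℝ × ℝ → EuclideanSpace ℝ (Fin n)) (z : ℝ × ℝ) : ℝ :=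
    ‖pd1 f z‖ ^ 2 + ‖pd2 f z‖ ^ 2

/-- The Laplacian `Δf = ∂²f/∂x² + ∂²f/∂y²`. -/
noncomputable def lap {n : ℕ} (f : ℝ × ℝ → EuclideanSpace ℝ (Fin n)) (z : ℝ × ℝ) :
    EuclideanSpace ℝ (Fin n) := pd1 (pd1 f) z + pd2 (pd2 f) z

/-- The Willmore energy `W(f, Ω) = ∫_{Ω ∩ {∇f ≠ 0}} |Δf|²/|∇f|²`. -/
noncomputable def willmore {n : ℕ} (f : ℝ × ℝ → EuclideanSpace ℝ (Fin n))
    (Ω : Set (ℝ × ℝ)) : ℝ≥0∞ :=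
  ∫⁻ z in Ω ∩ {w | gradSq f w ≠ 0}, ENNReal.ofReal (‖lap f z‖ ^ 2 / gradSq f z)

/-- **Wirtinger's inequality** for real functions of period `2π` and mean zero. -/
theorem wirtinger_real {u u' : ℝ → ℝ} (hu : ∀ x, HasDerivAt u (u' x) x) (hu' : Continuous u')
    (hper : u (2 * π) = u 0) (hmean : ∫ x in (0:ℝ)..2 * π, u x = 0) :
    ∫ x in (0:ℝ)..2 * π, u x ^ 2 ≤ ∫ x in (0:ℝ)..2 * π, u' x ^ 2 := by
  have hpos : (0:ℝ) < 2 * π := by positivity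
  have hcu : Continuous u := continuous_iff_continuousAt.2 fun x => (hu x).continuousAt
  have hasSum : ∀ v : ℝ → ℝ, Continuous v →
      HasSum (fun i => ‖fourierCoeffOn hpos (fun x => (v x : ℂ)) i‖ ^ 2)
        ((2 * π - 0)⁻¹ • ∫ x in (0:ℝ)..2 * π, v x ^ 2) := fun v hv => by
    have hm : MemLp (fun x => (v x : ℂ)) 2 (volume.restrict (Ioc 0 (2 * π))) := by
      rw [memLp_two_iff_integrable_sq_norm
        (by fun_prop : Continuous fun x => (v x : ℂ)).aestronglyMeasurable]
      exact (Continuous.integrableOn_Icc (by fun_prop)).mono_set Ioc_subset_Icc_self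
    simpa using hasSum_sq_fourierCoeffOn hpos hm
  have hle : ∀ i, ‖fourierCoeffOn hpos (fun x => (u x : ℂ)) i‖ ^ 2 ≤
      ‖fourierCoeffOn hpos (fun x => (u' x : ℂ)) i‖ ^ 2 := by
    intro i
    rcases eq_or_ne i 0 with rfl | hi
    · have : fourierCoeffOn hpos (fun x => (u x : ℂ)) 0 = 0 := by
        rw [fourierCoeffOn_eq_integral]
        simp [intervalIntegral.integral_ofReal, hmean]
      rw [this]
      simp
    · rw [fourierCoeffOn_of_hasDerivAt hpos hi (fun x _ => (hu x).ofReal_comp)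
        (Continuous.intervalIntegrable (by fun_prop) _ _), hper]
      have h1 : (1:ℝ) ≤ |(i:ℝ)| := by exact_mod_cast Int.one_le_abs hi
      have h2 : ‖fourierCoeffOn hpos (fun x => (u' x : ℂ)) i‖ =
          |(i:ℝ)| * (|(i:ℝ)|⁻¹ * ‖fourierCoeffOn hpos (fun x => (u' x : ℂ)) i‖) := by
        field_simp
      gcongr
      simp only [sub_self, mul_zero, zero_sub, norm_mul, norm_neg, norm_div, norm_one,
        Complex.norm_real, Complex.norm_I, Complex.norm_intCast, Complex.ofReal_zero, sub_zero,
        Complex.norm_ofNat, Complex.ofReal_mul, Complex.ofReal_ofNat, Real.norm_eq_abs,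
        abs_of_pos Real.pi_pos]
      have hpi := Real.pi_pos
      rw [div_mul_eq_mul_div, div_le_iff₀ (by positivity)]
      nlinarith [norm_nonneg (fourierCoeffOn hpos (fun x => (u' x : ℂ)) i),
        mul_nonneg hpi.le (norm_nonneg (fourierCoeffOn hpos (fun x => (u' x : ℂ)) i))]
  have := hasSum_le hle (hasSum u hcu) (hasSum u' hu')
  rw [smul_eq_mul, smul_eq_mul] at this
  exact le_of_mul_le_mul_left this (by simpa using hpos)

/-- **Wirtinger's inequality** for closed curves in Euclidean space. -/
theorem wirtinger_euclidean {n : ℕ} {u u' : ℝ → EuclideanSpace ℝ (Fin n)}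
    (hu : ∀ x, HasDerivAt u (u' x) x) (hu' : Continuous u') (hper : u (2 * π) = u 0) :
    ∫ x in (0:ℝ)..2 * π, ‖u x - (2 * π)⁻¹ • ∫ y in (0:ℝ)..2 * π, u y‖ ^ 2 ≤
      ∫ x in (0:ℝ)..2 * π, ‖u' x‖ ^ 2 := by
  have hcu : Continuous u := continuous_iff_continuousAt.2 fun x => (hu x).continuousAt
  set m := (2 * π)⁻¹ • ∫ y in (0:ℝ)..2 * π, u y with hm
  have hmi : ∀ i, m i = (2 * π)⁻¹ * ∫ y in (0:ℝ)..2 * π, u y i := fun i => by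
    have := (EuclideanSpace.proj (𝕜 := ℝ) i).intervalIntegral_comp_comm
      (hcu.intervalIntegrable (μ := volume) 0 (2 * π))
    rw [hm, PiLp.smul_apply, smul_eq_mul]
    exact congrArg _ this.symm
  simp_rw [EuclideanSpace.real_norm_sq_eq]
  rw [intervalIntegral.integral_finsetSum fun i _ =>
      Continuous.intervalIntegrable (by fun_prop) _ _,
    intervalIntegral.integral_finsetSum fun i _ =>
      Continuous.intervalIntegrable (by fun_prop) _ _]
  refine Finset.sum_le_sum fun i _ => wirtinger_real (fun x => ?_) (by fun_prop) ?_ ?_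
  · exact (EuclideanSpace.proj (𝕜 := ℝ) i).hasFDerivAt.comp_hasDerivAt x ((hu x).sub_const m)
  · rw [hper]
  · simp only [PiLp.sub_apply]
    rw [intervalIntegral.integral_sub (Continuous.intervalIntegrable (by fun_prop) _ _)
      intervalIntegrable_const, intervalIntegral.integral_const, hmi]
    have := Real.pi_ne_zero
    simp only [sub_zero, smul_eq_mul]
    field_simp
    ring

/-- Cauchy-Schwarz against the constant function. -/
theorem sq_integral_le {p : ℝ → ℝ} (hp : Continuous p) {a b : ℝ} (hab : a ≤ b) :
    (∫ x in a..b, p x) ^ 2 ≤ (b - a) * ∫ x in a..b, p x ^ 2 := by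
  rcases hab.eq_or_lt with rfl | hlt
  · simp
  set m := (∫ x in a..b, p x) / (b - a) with hm
  have hba : 0 < b - a := sub_pos.2 hlt
  have h0 : 0 ≤ ∫ x in a..b, (p x - m) ^ 2 :=
    intervalIntegral.integral_nonneg hab fun x _ => sq_nonneg _
  have h1 : ∫ x in a..b, (p x - m) ^ 2 =
      (∫ x in a..b, p x ^ 2) - 2 * m * (∫ x in a..b, p x) + (b - a) * m ^ 2 := by
    have : ∀ x, (p x - m) ^ 2 = p x ^ 2 - 2 * m * p x + m ^ 2 := fun x => by ring
    simp_rw [this]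
    rw [intervalIntegral.integral_add, intervalIntegral.integral_sub,
      intervalIntegral.integral_const_mul, intervalIntegral.integral_const, smul_eq_mul]
    all_goals exact Continuous.intervalIntegrable (by fun_prop) _ _
  have h2 : (∫ x in a..b, p x) = (b - a) * m := by rw [hm]; field_simp
  rw [h1, h2] at h0
  rw [h2]
  nlinarith

theorem hasDerivAt_parametric_intervalIntegral {E : Type*} [NormedAddCommGroup E] [NormedSpace ℝ E]
    {F F' : ℝ × ℝ → E} (hF : Continuous F) (hF' : Continuous F')
    (h : ∀ t θ, HasDerivAt (fun s => F (s, θ)) (F' (t, θ)) t) (a b t : ℝ) :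
    HasDerivAt (fun s => ∫ θ in a..b, F (s, θ)) (∫ θ in a..b, F' (t, θ)) t := by
  obtain ⟨M, hM⟩ := ((isCompact_Icc (a := t - 1) (b := t + 1)).prod
    (isCompact_uIcc (a := a) (b := b))).exists_bound_of_continuousOn hF'.continuousOn
  refine (intervalIntegral.hasDerivAt_integral_of_dominated_loc_of_deriv_le
    (F := fun s θ => F (s, θ)) (F' := fun s θ => F' (s, θ)) (bound := fun _ => M)
    (Icc_mem_nhds (by linarith : t - 1 < t) (by linarith : t < t + 1)) ?_ ?_ ?_ ?_ ?_ ?_).2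
  · exact Eventually.of_forall fun s => Continuous.aestronglyMeasurable (by fun_prop)
  · exact Continuous.intervalIntegrable (by fun_prop) _ _
  · exact Continuous.aestronglyMeasurable (by fun_prop)
  · exact Eventually.of_forall fun θ hθ s hs => hM (s, θ) ⟨hs, uIoc_subset_uIcc hθ⟩
  · exact intervalIntegrable_const
  · exact Eventually.of_forall fun θ _ s _ => h s θ

theorem setIntegral_Icc_prod_Icc {h : ℝ × ℝ → ℝ} (hh : Continuous h) {a b c d : ℝ} (hab : a ≤ b)
    (hcd : c ≤ d) :
    ∫ z in Icc a b ×ˢ Icc c d, h z = ∫ t in a..b, ∫ θ in c..d, h (t, θ) := by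
  have hint : IntegrableOn h (Icc a b ×ˢ Icc c d) (volume.prod volume) := by
    rw [← Measure.volume_eq_prod]
    exact hh.continuousOn.integrableOn_compact (isCompact_Icc.prod isCompact_Icc)
  rw [Measure.volume_eq_prod, setIntegral_prod _ hint, intervalIntegral.integral_of_le hab,
    integral_Icc_eq_integral_Ioc]
  simp_rw [intervalIntegral.integral_of_le hcd, integral_Icc_eq_integral_Ioc]

theorem exists_le_intervalIntegral {G : ℝ → ℝ} (hG : Continuous G) (s : ℝ) :
    ∃ a ∈ Icc s (s + 1), G a ≤ ∫ x in s..s + 1, G x := by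
  obtain ⟨a, ha, hmin⟩ := isCompact_Icc.exists_isMinOn
    (nonempty_Icc.2 (by linarith : s ≤ s + 1)) hG.continuousOn
  refine ⟨a, ha, ?_⟩
  have := intervalIntegral.integral_mono_on (μ := volume) (by linarith : s ≤ s + 1)
    (intervalIntegrable_const (c := G a)) (hG.intervalIntegrable s (s + 1))
    (fun x hx => hmin hx)
  simpa using this

/-- The standing assumptions: `f` is smooth, `2π`-periodic in the second variable and weakly
conformal, and its Laplacian vanishes at its critical points. -/
structure IsConformalCylinder {n : ℕ} (f : ℝ × ℝ → EuclideanSpace ℝ (Fin n)) : Prop where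
  smooth : ContDiff ℝ (⊤ : ℕ∞) f
  periodic : ∀ t θ : ℝ, f (t, θ + 2 * π) = f (t, θ)
  conformal : ∀ z, ‖pd1 f z‖ ^ 2 = ‖pd2 f z‖ ^ 2 ∧ ⟪pd1 f z, pd2 f z⟫ = 0
  lap_eq_zero : ∀ z, fderiv ℝ f z = 0 → lap f z = 0

section PartialDerivatives

variable {n : ℕ} {f : ℝ × ℝ → EuclideanSpace ℝ (Fin n)}

theorem ContDiff.pd1 (hf : ContDiff ℝ (⊤ : ℕ∞) f) : ContDiff ℝ (⊤ : ℕ∞) (pd1 f) :=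
  (hf.fderiv_right (m := (⊤ : ℕ∞)) (by simp)).clm_apply contDiff_const

theorem ContDiff.pd2 (hf : ContDiff ℝ (⊤ : ℕ∞) f) : ContDiff ℝ (⊤ : ℕ∞) (pd2 f) :=
  (hf.fderiv_right (m := (⊤ : ℕ∞)) (by simp)).clm_apply contDiff_const

theorem fderiv_apply_eq_pd (z h : ℝ × ℝ) : fderiv ℝ f z h = h.1 • pd1 f z + h.2 • pd2 f z := by
  have : h = h.1 • ((1, 0) : ℝ × ℝ) + h.2 • ((0, 1) : ℝ × ℝ) := by ext <;> simp
  conv_lhs => rw [this, map_add, map_smul, map_smul]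
  rfl

theorem hasDerivAt_pd1 (hf : ContDiff ℝ (⊤ : ℕ∞) f) (t θ : ℝ) :
    HasDerivAt (fun s => f (s, θ)) (pd1 f (t, θ)) t :=
  (hf.differentiable (by simp) (t, θ)).hasFDerivAt.comp_hasDerivAt t
    ((hasDerivAt_id t).prodMk (hasDerivAt_const t θ))

theorem hasDerivAt_pd2 (hf : ContDiff ℝ (⊤ : ℕ∞) f) (t θ : ℝ) :
    HasDerivAt (fun s => f (t, s)) (pd2 f (t, θ)) θ :=
  (hf.differentiable (by simp) (t, θ)).hasFDerivAt.comp_hasDerivAt θ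
    ((hasDerivAt_const θ t).prodMk (hasDerivAt_id θ))

theorem pd1_pd2_comm (hf : ContDiff ℝ (⊤ : ℕ∞) f) (z : ℝ × ℝ) :
    pd1 (pd2 f) z = pd2 (pd1 f) z := by
  have hd : DifferentiableAt ℝ (fderiv ℝ f) z :=
    (hf.fderiv_right (m := (⊤ : ℕ∞)) (by simp)).differentiable (by simp) z
  have key : ∀ v w : ℝ × ℝ, fderiv ℝ (fun x => fderiv ℝ f x v) z w = fderiv ℝ (fderiv ℝ f) z w v :=
    fun v w => by
      rw [fderiv_clm_apply hd (differentiableAt_const v)]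
      simp
  change fderiv ℝ (fun x => fderiv ℝ f x (0, 1)) z (1, 0) =
    fderiv ℝ (fun x => fderiv ℝ f x (1, 0)) z (0, 1)
  rw [key, key]
  exact (hf.contDiffAt.isSymmSndFDerivAt (by simp; exact WithTop.coe_le_coe.2 le_top)).eq _ _

theorem gradSq_nonneg (z : ℝ × ℝ) : 0 ≤ gradSq f z := by
  rw [gradSq]
  positivity

end PartialDerivatives

namespace IsConformalCylinder

variable {n : ℕ} {f : ℝ × ℝ → EuclideanSpace ℝ (Fin n)} (hf : IsConformalCylinder f)
include hf

theorem continuous_pd1 : Continuous (pd1 f) := hf.smooth.pd1.continuous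

theorem continuous_pd2 : Continuous (pd2 f) := hf.smooth.pd2.continuous

theorem continuous_lap : Continuous (lap f) :=
  hf.smooth.pd1.pd1.continuous.add hf.smooth.pd2.pd2.continuous

theorem continuous_gradSq : Continuous (gradSq f) :=
  (hf.continuous_pd1.norm.pow 2).add (hf.continuous_pd2.norm.pow 2)

theorem pd2_periodic (t θ : ℝ) : pd2 f (t, θ + 2 * π) = pd2 f (t, θ) := by
  have h := (hasDerivAt_pd2 hf.smooth t (θ + 2 * π)).comp_add_const θ (2 * π)
  simp_rw [hf.periodic] at h
  exact h.unique (hasDerivAt_pd2 hf.smooth t θ)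

theorem eq_two_pi (t : ℝ) : f (t, 2 * π) = f (t, 0) := by simpa using hf.periodic t 0

theorem gradSq_eq (z : ℝ × ℝ) : gradSq f z = 2 * ‖pd2 f z‖ ^ 2 := by
  rw [gradSq, (hf.conformal z).1]
  ring

theorem lap_eq_zero_of_gradSq_eq_zero {z : ℝ × ℝ} (h : gradSq f z = 0) : lap f z = 0 := by
  have h2 : pd2 f z = 0 := by
    have := hf.gradSq_eq z
    rw [h] at this
    simpa using this.symm
  have h1 : pd1 f z = 0 := by
    have := (hf.conformal z).1
    rw [h2] at this
    simpa using this
  refine hf.lap_eq_zero z (ContinuousLinearMap.ext fun v => ?_)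
  rw [fderiv_apply_eq_pd, h1, h2]
  simp

theorem inner_lap_pd (z : ℝ × ℝ) : ⟪lap f z, pd1 f z⟫ = 0 ∧ ⟪lap f z, pd2 f z⟫ = 0 := by
  obtain ⟨t, θ⟩ := z
  have h11 := hasDerivAt_pd1 hf.smooth.pd1 t θ
  have h12 := hasDerivAt_pd2 hf.smooth.pd1 t θ
  have h21 := hasDerivAt_pd1 hf.smooth.pd2 t θ
  have h22 := hasDerivAt_pd2 hf.smooth.pd2 t θ
  rw [pd1_pd2_comm hf.smooth] at h21
  have e1 : HasDerivAt (fun s => ‖pd1 f (s, θ)‖ ^ 2) _ t := h11.norm_sq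
  have e2 : HasDerivAt (fun s => ‖pd1 f (t, s)‖ ^ 2) _ θ := h12.norm_sq
  simp_rw [fun z => (hf.conformal z).1] at e1 e2
  have e3 := h11.inner ℝ h21
  have e4 := h12.inner ℝ h22
  simp_rw [fun z => (hf.conformal z).2] at e3 e4
  have i1 := e1.unique h21.norm_sq
  have i2 := e2.unique h22.norm_sq
  have i3 := e3.unique (hasDerivAt_const t (0:ℝ))
  have i4 := e4.unique (hasDerivAt_const θ (0:ℝ))
  simp only [lap, inner_add_left]
  rw [real_inner_comm (pd2 f (t, θ)) (pd1 (pd1 f) (t, θ)),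
    real_inner_comm (pd1 f (t, θ)) (pd1 (pd1 f) (t, θ)),
    real_inner_comm (pd2 f (t, θ)) (pd2 (pd2 f) (t, θ)),
    real_inner_comm (pd1 f (t, θ)) (pd2 (pd2 f) (t, θ))]
  rw [real_inner_comm (pd2 f (t, θ)) (pd1 (pd1 f) (t, θ))] at i3
  rw [real_inner_comm (pd2 f (t, θ)) (pd2 (pd1 f) (t, θ))] at i4
  constructor <;> linarith

end IsConformalCylinder

/-- The pointwise inequality behind Simon's monotonicity formula: `D` is normal to the conformal
frame `u`, `v` and only the normal part of `X` is paired with it. -/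
theorem monotonicity_pointwise {E : Type*} [NormedAddCommGroup E] [InnerProductSpace ℝ E]
    {X u v D : E} (huv : ‖u‖ ^ 2 = ‖v‖ ^ 2) (ho : ⟪u, v⟫ = 0) (hu : ⟪D, u⟫ = 0) (hv : ⟪D, v⟫ = 0)
    (hD : ‖u‖ ^ 2 + ‖v‖ ^ 2 = 0 → D = 0) {p p' : ℝ} (hp : p ^ 2 ≤ -p') :
    (‖u‖ ^ 2 + ‖v‖ ^ 2) * (p + ‖X‖ ^ 2 * p') - ‖D‖ ^ 2 / (‖u‖ ^ 2 + ‖v‖ ^ 2) / 4 ≤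
      p * (‖u‖ ^ 2 + ‖v‖ ^ 2 + ⟪X, D⟫) + 2 * p' * (⟪X, u⟫ ^ 2 + ⟪X, v⟫ ^ 2) := by
  rcases eq_or_ne (‖u‖ ^ 2 + ‖v‖ ^ 2) 0 with h0 | h0
  · have hu0 : u = 0 := by
      have : ‖u‖ ^ 2 = 0 := by nlinarith [sq_nonneg ‖u‖, sq_nonneg ‖v‖]
      simpa using this
    have hv0 : v = 0 := by
      have : ‖v‖ ^ 2 = 0 := by nlinarith [sq_nonneg ‖u‖, sq_nonneg ‖v‖]
      simpa using this
    simp [hD h0, hu0, hv0]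
  set l := ‖u‖ ^ 2 with hl
  have hlpos : 0 < l := lt_of_le_of_ne (sq_nonneg _) fun h => h0 (by rw [← huv, ← h]; simp)
  set B := l * ‖X‖ ^ 2 - ⟪X, u⟫ ^ 2 - ⟪X, v⟫ ^ 2 with hB
  set Y := l • X - ⟪X, u⟫ • u - ⟪X, v⟫ • v with hY
  have hYD : ⟪Y, D⟫ = l * ⟪X, D⟫ := by
    rw [hY, inner_sub_left, inner_sub_left, real_inner_smul_left, real_inner_smul_left,
      real_inner_smul_left, real_inner_comm D u, real_inner_comm D v, hu, hv]
    ring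
  have hYY : ‖Y‖ ^ 2 = l * B := by
    rw [← real_inner_self_eq_norm_sq, hY]
    simp only [inner_sub_left, inner_sub_right, real_inner_smul_left, real_inner_smul_right,
      real_inner_self_eq_norm_sq, ho, real_inner_comm u v, real_inner_comm X u,
      real_inner_comm X v, norm_smul, mul_pow, Real.norm_eq_abs, sq_abs]
    rw [hB, ← huv, ← hl]
    ring
  have hCS : (l * ⟪X, D⟫) ^ 2 ≤ l * B * ‖D‖ ^ 2 := by
    rw [← hYD, ← hYY, ← mul_pow]
    exact sq_le_sq' (neg_le_of_abs_le (abs_real_inner_le_norm Y D))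
      ((le_abs_self _).trans (abs_real_inner_le_norm Y D))
  have hB0 : 0 ≤ B := by
    have : 0 ≤ l * B := hYY ▸ sq_nonneg _
    exact nonneg_of_mul_nonneg_right this hlpos
  rw [← huv]
  set w := ‖D‖ ^ 2 / (l + l) with hw
  have hw0 : 0 ≤ w := by positivity
  have hDw : ‖D‖ ^ 2 = 2 * l * w := by rw [hw]; field_simp; ring
  have h1 : ⟪X, D⟫ ^ 2 ≤ 2 * B * w := by
    rw [hDw] at hCS
    have : l ^ 2 * ⟪X, D⟫ ^ 2 ≤ l ^ 2 * (2 * B * w) := by nlinarith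
    exact le_of_mul_le_mul_left this (by positivity)
  have h2 : |p * ⟪X, D⟫| ≤ 2 * p ^ 2 * B + w / 4 := by
    refine abs_le_of_sq_le_sq ?_ (by positivity)
    have : p ^ 2 * ⟪X, D⟫ ^ 2 ≤ p ^ 2 * (2 * B * w) := by gcongr
    nlinarith [sq_nonneg (2 * p ^ 2 * B - w / 4)]
  have h3 := neg_le_of_abs_le h2
  have h4 : p ^ 2 * B ≤ -p' * B := by gcongr
  have h5 : ⟪X, u⟫ ^ 2 + ⟪X, v⟫ ^ 2 = l * ‖X‖ ^ 2 - B := by rw [hB]; ring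
  rw [h5]
  nlinarith

theorem hasDerivAt_max_zero_sq (x : ℝ) :
    HasDerivAt (fun y : ℝ => max y 0 ^ 2) (2 * max x 0) x := by
  rcases lt_trichotomy x 0 with hx | rfl | hx
  · rw [max_eq_right hx.le, mul_zero]
    refine (hasDerivAt_const x (0:ℝ)).congr_of_eventuallyEq ?_
    filter_upwards [Iio_mem_nhds hx] with y hy
    rw [max_eq_right (le_of_lt hy)]
    simp
  · rw [max_self, mul_zero, hasDerivAt_iff_isLittleO_nhds_zero]
    have h : (fun h : ℝ => h ^ 2) =o[nhds 0] fun h => h := by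
      simpa using Asymptotics.isLittleO_pow_pow (𝕜 := ℝ) (m := 1) (n := 2) (by norm_num)
    refine Asymptotics.IsBigO.trans_isLittleO ?_ h
    refine Asymptotics.IsBigO.of_bound 1 (Eventually.of_forall fun y => ?_)
    simp only [zero_add, max_self, ne_eq, OfNat.ofNat_ne_zero, not_false_eq_true, zero_pow,
      sub_zero, smul_zero, norm_pow, Real.norm_eq_abs, one_mul]
    refine pow_le_pow_left₀ (abs_nonneg _) ?_ 2
    rw [abs_of_nonneg (le_max_right y 0)]
    exact max_le (le_abs_self y) (abs_nonneg y)
  · rw [max_eq_left hx.le]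
    have : HasDerivAt (fun y : ℝ => y ^ 2) (2 * x) x := by simpa using hasDerivAt_pow 2 x
    refine this.congr_of_eventuallyEq ?_
    filter_upwards [Ioi_mem_nhds hx] with y hy
    rw [max_eq_left (le_of_lt hy)]

/-- The squared cutoff `(1 - q / S)₊²` at height `S`. -/
noncomputable def cutoff (S q : ℝ) : ℝ := max (1 - q / S) 0 ^ 2

/-- The weight `(1 - q / S)₊² / (q + δ)` in the monotonicity formula. -/
noncomputable def weight (S δ q : ℝ) : ℝ := cutoff S q / (q + δ)

/-- The derivative of `weight S δ`. -/
noncomputable def weightDeriv (S δ q : ℝ) : ℝ :=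
  -(2 * max (1 - q / S) 0 / S / (q + δ)) - cutoff S q / (q + δ) ^ 2

section Weight

variable {S δ q : ℝ}

theorem cutoff_nonneg : 0 ≤ cutoff S q := sq_nonneg _

theorem cutoff_le_one (hS : 0 < S) (hq : 0 ≤ q) : cutoff S q ≤ 1 := by
  refine pow_le_one₀ (le_max_right _ _) (max_le ?_ zero_le_one)
  have : 0 ≤ q / S := by positivity
  linarith

theorem weight_eq_zero (hS : 0 < S) (hq : S ≤ q) : weight S δ q = 0 := by
  have : 1 - q / S ≤ 0 := by
    have := (one_le_div hS).2 hq
    linarith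
  simp [weight, cutoff, max_eq_right this]

theorem hasDerivAt_weight (hδ : 0 < δ) (hq : 0 ≤ q) :
    HasDerivAt (weight S δ) (weightDeriv S δ q) q := by
  have h1 : HasDerivAt (fun q => 1 - q / S) (-(1 / S)) q :=
    ((hasDerivAt_id q).div_const S).const_sub 1
  have h2 : HasDerivAt (cutoff S) (2 * max (1 - q / S) 0 * -(1 / S)) q :=
    HasDerivAt.comp (h₂ := fun y => max y 0 ^ 2) q (hasDerivAt_max_zero_sq (1 - q / S)) h1
  have hne : q + δ ≠ 0 := by positivity
  refine (h2.div ((hasDerivAt_id q).add_const δ) hne).congr_deriv ?_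
  simp only [id, weightDeriv]
  field_simp

theorem continuous_weight_comp {X : Type*} [TopologicalSpace X] {r : X → ℝ} (hr : Continuous r)
    (hr0 : ∀ x, 0 ≤ r x) (hδ : 0 < δ) : Continuous fun x => weight S δ (r x) := by
  have : ∀ x, r x + δ ≠ 0 := fun x => by have := hr0 x; positivity
  unfold weight cutoff
  fun_prop (disch := assumption)

theorem continuous_weightDeriv_comp {X : Type*} [TopologicalSpace X] {r : X → ℝ}
    (hr : Continuous r) (hr0 : ∀ x, 0 ≤ r x) (hδ : 0 < δ) :
    Continuous fun x => weightDeriv S δ (r x) := by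
  have : ∀ x, r x + δ ≠ 0 := fun x => by have := hr0 x; positivity
  have h2 : ∀ x, (r x + δ) ^ 2 ≠ 0 := fun x => pow_ne_zero 2 (this x)
  unfold weightDeriv cutoff
  fun_prop (disch := assumption)

theorem weight_sq_le (hS : 0 < S) (hδ : 0 < δ) (hq : 0 ≤ q) :
    weight S δ q ^ 2 ≤ -weightDeriv S δ q := by
  have h1 : weight S δ q ^ 2 ≤ cutoff S q / (q + δ) ^ 2 := by
    rw [weight, div_pow]
    gcongr
    nlinarith [cutoff_nonneg (S := S) (q := q), cutoff_le_one hS hq]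
  have h2 : 0 ≤ 2 * max (1 - q / S) 0 / S / (q + δ) := by positivity
  rw [weightDeriv]
  linarith

theorem le_weight_add_mul_weightDeriv (hS : 0 < S) (hδ : 0 < δ) (hq : 0 ≤ q) :
    cutoff S q * δ / (q + δ) ^ 2 - 2 / S ≤ weight S δ q + q * weightDeriv S δ q := by
  have h1 : weight S δ q + q * weightDeriv S δ q =
      cutoff S q * δ / (q + δ) ^ 2 - 2 / S * (max (1 - q / S) 0 * (q / (q + δ))) := by
    rw [weight, weightDeriv]
    field_simp
    ring
  have h2 : max (1 - q / S) 0 ≤ 1 := max_le (by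
    have : 0 ≤ q / S := by positivity
    linarith) zero_le_one
  have h3 : q / (q + δ) ≤ 1 := (div_le_one (by positivity)).2 (by linarith)
  have h4 : max (1 - q / S) 0 * (q / (q + δ)) ≤ 1 :=
    mul_le_one₀ h2 (by positivity) h3
  have h5 : 2 / S * (max (1 - q / S) 0 * (q / (q + δ))) ≤ 2 / S :=
    mul_le_of_le_one_right (by positivity) h4
  linarith

end Weight

/-- The divergence theorem on a cylinder for a field with vanishing flux through the ends. -/
theorem integral_divergence_eq_zero {P P' Q Q' : ℝ × ℝ → ℝ} (cP : Continuous P)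
    (cP' : Continuous P') (cQ' : Continuous Q')
    (hP : ∀ t θ, HasDerivAt (fun s => P (s, θ)) (P' (t, θ)) t)
    (hQ : ∀ t θ, HasDerivAt (fun s => Q (t, s)) (Q' (t, θ)) θ)
    (hper : ∀ t, Q (t, 2 * π) = Q (t, 0)) {a b : ℝ} (ha : ∀ θ, P (a, θ) = 0)
    (hb : ∀ θ, P (b, θ) = 0) :
    ∫ t in a..b, ∫ θ in (0:ℝ)..2 * π, (P' (t, θ) + Q' (t, θ)) = 0 := by
  have h1 : ∀ t, ∫ θ in (0:ℝ)..2 * π, (P' (t, θ) + Q' (t, θ)) =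
      ∫ θ in (0:ℝ)..2 * π, P' (t, θ) := fun t => by
    rw [intervalIntegral.integral_add (Continuous.intervalIntegrable (by fun_prop) _ _)
      (Continuous.intervalIntegrable (by fun_prop) _ _),
      intervalIntegral.integral_eq_sub_of_hasDerivAt (fun θ _ => hQ t θ)
        (Continuous.intervalIntegrable (by fun_prop) _ _), hper t]
    simp
  simp_rw [h1]
  rw [intervalIntegral.integral_eq_sub_of_hasDerivAt
    (fun t _ => hasDerivAt_parametric_intervalIntegral cP cP' hP 0 (2 * π) t)
    (Continuous.intervalIntegrable (by fun_prop) _ _)]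
  simp [ha, hb]

namespace IsConformalCylinder

variable {n : ℕ} {f : ℝ × ℝ → EuclideanSpace ℝ (Fin n)} (hf : IsConformalCylinder f)
include hf

theorem weighted_area_le (c : EuclideanSpace ℝ (Fin n)) {a b S δ : ℝ} (hab : a ≤ b) (hS : 0 < S)
    (hδ : 0 < δ) (ha : ∀ θ, S ≤ ‖f (a, θ) - c‖ ^ 2) (hb : ∀ θ, S ≤ ‖f (b, θ) - c‖ ^ 2)
    (hw : IntegrableOn (fun z => ‖lap f z‖ ^ 2 / gradSq f z) (Icc a b ×ˢ Icc 0 (2 * π))) :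
    ∫ z in Icc a b ×ˢ Icc 0 (2 * π),
        gradSq f z * (cutoff S (‖f z - c‖ ^ 2) * δ / (‖f z - c‖ ^ 2 + δ) ^ 2) ≤
      2 / S * (∫ z in Icc a b ×ˢ Icc 0 (2 * π), gradSq f z) +
        1 / 4 * ∫ z in Icc a b ×ˢ Icc 0 (2 * π), ‖lap f z‖ ^ 2 / gradSq f z := by
  set q : ℝ × ℝ → ℝ := fun z => ‖f z - c‖ ^ 2 with hq
  have cf := hf.smooth.continuous
  have c1 := hf.continuous_pd1
  have c2 := hf.continuous_pd2
  have c11 := hf.smooth.pd1.pd1.continuous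
  have c22 := hf.smooth.pd2.pd2.continuous
  have cg := hf.continuous_gradSq
  have cq : Continuous q := by fun_prop
  have q0 : ∀ z, 0 ≤ q z := fun z => sq_nonneg _
  have cW := continuous_weight_comp (S := S) cq q0 hδ
  have cW' := continuous_weightDeriv_comp (S := S) cq q0 hδ
  have hq1 : ∀ t θ, HasDerivAt (fun s => q (s, θ)) (2 * ⟪f (t, θ) - c, pd1 f (t, θ)⟫) t :=
    fun t θ => ((hasDerivAt_pd1 hf.smooth t θ).sub_const c).norm_sq
  have hq2 : ∀ t θ, HasDerivAt (fun s => q (t, s)) (2 * ⟪f (t, θ) - c, pd2 f (t, θ)⟫) θ :=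
    fun t θ => ((hasDerivAt_pd2 hf.smooth t θ).sub_const c).norm_sq
  have hP : ∀ t θ, HasDerivAt
      (fun s => weight S δ (q (s, θ)) * ⟪f (s, θ) - c, pd1 f (s, θ)⟫)
      (weightDeriv S δ (q (t, θ)) * (2 * ⟪f (t, θ) - c, pd1 f (t, θ)⟫) *
        ⟪f (t, θ) - c, pd1 f (t, θ)⟫ + weight S δ (q (t, θ)) *
        (⟪f (t, θ) - c, pd1 (pd1 f) (t, θ)⟫ + ⟪pd1 f (t, θ), pd1 f (t, θ)⟫)) t := fun t θ =>
    (HasDerivAt.comp (h₂ := weight S δ) t (hasDerivAt_weight hδ (q0 (t, θ))) (hq1 t θ)).mul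
      (((hasDerivAt_pd1 hf.smooth t θ).sub_const c).inner ℝ (hasDerivAt_pd1 hf.smooth.pd1 t θ))
  have hQ : ∀ t θ, HasDerivAt
      (fun s => weight S δ (q (t, s)) * ⟪f (t, s) - c, pd2 f (t, s)⟫)
      (weightDeriv S δ (q (t, θ)) * (2 * ⟪f (t, θ) - c, pd2 f (t, θ)⟫) *
        ⟪f (t, θ) - c, pd2 f (t, θ)⟫ + weight S δ (q (t, θ)) *
        (⟪f (t, θ) - c, pd2 (pd2 f) (t, θ)⟫ + ⟪pd2 f (t, θ), pd2 f (t, θ)⟫)) θ := fun t θ =>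
    (HasDerivAt.comp (h₂ := weight S δ) θ (hasDerivAt_weight hδ (q0 (t, θ))) (hq2 t θ)).mul
      (((hasDerivAt_pd2 hf.smooth t θ).sub_const c).inner ℝ (hasDerivAt_pd2 hf.smooth.pd2 t θ))
  have hdiv := integral_divergence_eq_zero
    (P := fun z => weight S δ (q z) * ⟪f z - c, pd1 f z⟫)
    (Q := fun z => weight S δ (q z) * ⟪f z - c, pd2 f z⟫)
    (P' := fun z => weightDeriv S δ (q z) * (2 * ⟪f z - c, pd1 f z⟫) *
        ⟪f z - c, pd1 f z⟫ + weight S δ (q z) *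
        (⟪f z - c, pd1 (pd1 f) z⟫ + ⟪pd1 f z, pd1 f z⟫))
    (Q' := fun z => weightDeriv S δ (q z) * (2 * ⟪f z - c, pd2 f z⟫) *
        ⟪f z - c, pd2 f z⟫ + weight S δ (q z) *
        (⟪f z - c, pd2 (pd2 f) z⟫ + ⟪pd2 f z, pd2 f z⟫))
    (by fun_prop) (by fun_prop) (by fun_prop) hP hQ
    (fun t => by
      have := hf.pd2_periodic t 0
      rw [zero_add] at this
      simp only [hq, hf.eq_two_pi, this])
    (a := a) (b := b) (fun θ => by rw [weight_eq_zero hS (ha θ), zero_mul])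
    (fun θ => by rw [weight_eq_zero hS (hb θ), zero_mul])
  rw [← setIntegral_Icc_prod_Icc (h := fun z => (weightDeriv S δ (q z) * (2 * ⟪f z - c, pd1 f z⟫) *
        ⟪f z - c, pd1 f z⟫ + weight S δ (q z) *
        (⟪f z - c, pd1 (pd1 f) z⟫ + ⟪pd1 f z, pd1 f z⟫)) +
        (weightDeriv S δ (q z) * (2 * ⟪f z - c, pd2 f z⟫) *
        ⟪f z - c, pd2 f z⟫ + weight S δ (q z) *
        (⟪f z - c, pd2 (pd2 f) z⟫ + ⟪pd2 f z, pd2 f z⟫))) (by fun_prop) hab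
        (by positivity)] at hdiv
  have hK : IsCompact (Icc a b ×ˢ Icc 0 (2 * π)) := isCompact_Icc.prod isCompact_Icc
  have hne : ∀ z, (q z + δ) ^ 2 ≠ 0 := fun z => by have := q0 z; positivity
  have cC : Continuous fun z => cutoff S (q z) := by unfold cutoff; fun_prop
  have cM : Continuous fun z => gradSq f z * (cutoff S (q z) * δ / (q z + δ) ^ 2) := by
    fun_prop (disch := assumption)
  have hM : IntegrableOn (fun z => gradSq f z * (cutoff S (q z) * δ / (q z + δ) ^ 2))
    (Icc a b ×ˢ Icc 0 (2 * π)) := cM.continuousOn.integrableOn_compact hK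
  have hG : IntegrableOn (gradSq f) (Icc a b ×ˢ Icc 0 (2 * π)) :=
    cg.continuousOn.integrableOn_compact hK
  have hmono := integral_mono (μ := volume.restrict (Icc a b ×ˢ Icc 0 (2 * π)))
    ((hM.sub (hG.const_mul (2 / S))).sub (hw.const_mul (1 / 4)))
    (Continuous.continuousOn (by fun_prop) |>.integrableOn_compact hK) (fun z => ?_)
    |>.trans_eq hdiv
  · rw [integral_sub' (hM.sub (hG.const_mul (2 / S))) (hw.const_mul (1 / 4)),
      integral_sub' hM (hG.const_mul (2 / S)), integral_const_mul, integral_const_mul] at hmono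
    linarith
  · have h1 := monotonicity_pointwise (X := f z - c) (hf.conformal z).1 (hf.conformal z).2
      (hf.inner_lap_pd z).1 (hf.inner_lap_pd z).2
      (fun h => hf.lap_eq_zero_of_gradSq_eq_zero h) (weight_sq_le hS hδ (q0 z))
    have h2 := mul_le_mul_of_nonneg_left (le_weight_add_mul_weightDeriv hS hδ (q0 z))
      (gradSq_nonneg (f := f) z)
    simp only [lap, inner_add_right] at h1 ⊢
    simp only [Pi.sub_apply, real_inner_self_eq_norm_sq]
    simp only [gradSq] at h1 h2 ⊢
    simp only [hq] at h1 h2 ⊢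
    linarith

theorem exists_weighted_area_ge {a b : ℝ} {z₀ : ℝ × ℝ} (hz₀ : z₀ ∈ Ioo a b ×ˢ Ioo 0 (2 * π))
    (hg : gradSq f z₀ ≠ 0) {S : ℝ} (hS : 0 < S) :
    ∃ δ > 0, 1 / 100 ≤ ∫ z in Icc a b ×ˢ Icc 0 (2 * π),
      gradSq f z * (cutoff S (‖f z - f z₀‖ ^ 2) * δ / (‖f z - f z₀‖ ^ 2 + δ) ^ 2) := by
  obtain ⟨t₀, θ₀⟩ := z₀
  set z₀ : ℝ × ℝ := (t₀, θ₀)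
  set l := ‖pd2 f z₀‖ with hl
  have hl1 : ‖pd1 f z₀‖ = l :=
    (pow_left_inj₀ (norm_nonneg _) (norm_nonneg _) two_ne_zero).1 (hf.conformal z₀).1
  have hg2 : gradSq f z₀ = 2 * l ^ 2 := hf.gradSq_eq z₀
  have hlpos : 0 < l := lt_of_le_of_ne (norm_nonneg _) fun h => hg (by rw [hg2, ← h]; simp)
  have cf := hf.smooth.continuous
  have cg := hf.continuous_gradSq
  have cq : Continuous fun z => ‖f z - f z₀‖ ^ 2 := by fun_prop
  have e1 : ∀ᶠ z in nhds z₀, l ^ 2 < gradSq f z :=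
    cg.continuousAt.eventually (lt_mem_nhds (by rw [hg2]; nlinarith [pow_pos hlpos 2]))
  have e2 : ∀ᶠ z in nhds z₀, ‖f z - f z₀‖ ^ 2 < S / 2 :=
    cq.continuousAt.eventually (gt_mem_nhds (by simpa using hS))
  have e3 : ∀ᶠ z in nhds z₀, ‖f z - f z₀ - fderiv ℝ f z₀ (z - z₀)‖ ≤ l * ‖z - z₀‖ :=
    (hf.smooth.differentiable (by simp) z₀).hasFDerivAt.isLittleO.def hlpos
  have e4 : ∀ᶠ z in nhds z₀, z ∈ Ioo a b ×ˢ Ioo 0 (2 * π) :=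
    (isOpen_Ioo.prod isOpen_Ioo).mem_nhds hz₀
  obtain ⟨r, hr, hball⟩ := Metric.eventually_nhds_iff.1 (e1.and (e2.and (e3.and e4)))
  set η := r / 2 with hη
  have hηpos : 0 < η := by positivity
  have hbox : ∀ z ∈ Icc (t₀ - η) (t₀ + η) ×ˢ Icc (θ₀ - η) (θ₀ + η), ‖z - z₀‖ ≤ η := by
    rintro ⟨t, θ⟩ ⟨⟨h1, h2⟩, ⟨h3, h4⟩⟩
    simp only at h1 h2 h3 h4
    refine norm_prod_le_iff.2 ⟨abs_le.2 ⟨?_, ?_⟩, abs_le.2 ⟨?_, ?_⟩⟩ <;>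
      simp only [z₀, Prod.fst_sub, Prod.snd_sub] <;> linarith
  have hlt : ∀ z ∈ Icc (t₀ - η) (t₀ + η) ×ˢ Icc (θ₀ - η) (θ₀ + η), dist z z₀ < r :=
    fun z hz => by
      rw [dist_eq_norm]
      linarith [hbox z hz]
  set δ := l ^ 2 * η ^ 2 with hδ
  have hδpos : 0 < δ := by positivity
  refine ⟨δ, hδpos, ?_⟩
  set M : ℝ × ℝ → ℝ := fun z =>
    gradSq f z * (cutoff S (‖f z - f z₀‖ ^ 2) * δ / (‖f z - f z₀‖ ^ 2 + δ) ^ 2) with hM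
  have hne : ∀ z, (‖f z - f z₀‖ ^ 2 + δ) ^ 2 ≠ 0 := fun z => by positivity
  have cM : Continuous M := by
    unfold M cutoff
    fun_prop (disch := assumption)
  have hlow : ∀ z ∈ Icc (t₀ - η) (t₀ + η) ×ˢ Icc (θ₀ - η) (θ₀ + η), 1 / (400 * η ^ 2) ≤ M z := by
    intro z hz
    obtain ⟨b1, b2, b3, -⟩ := hball (hlt z hz)
    have hzη := hbox z hz
    have hD : ‖fderiv ℝ f z₀ (z - z₀)‖ ≤ 2 * l * η := by
      rw [fderiv_apply_eq_pd]
      refine (norm_add_le _ _).trans ?_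
      rw [norm_smul, norm_smul, hl1, ← hl]
      have i1 := (norm_fst_le (z - z₀)).trans hzη
      have i2 := (norm_snd_le (z - z₀)).trans hzη
      nlinarith
    have hq : ‖f z - f z₀‖ ≤ 3 * l * η := by
      have i1 := norm_sub_norm_le (f z - f z₀) (fderiv ℝ f z₀ (z - z₀))
      nlinarith
    have hq2 : ‖f z - f z₀‖ ^ 2 ≤ 9 * δ := by
      have := pow_le_pow_left₀ (norm_nonneg _) hq 2
      rw [hδ]
      linarith
    have hc : 1 / 4 ≤ cutoff S (‖f z - f z₀‖ ^ 2) := by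
      have i1 : ‖f z - f z₀‖ ^ 2 / S ≤ 1 / 2 := (div_le_iff₀ hS).2 (by linarith)
      have i2 : 1 / 2 ≤ max (1 - ‖f z - f z₀‖ ^ 2 / S) 0 := le_max_of_le_left (by linarith)
      have := pow_le_pow_left₀ (by norm_num) i2 2
      rw [cutoff]
      linarith
    have hfrac : 1 / 4 * δ / (9 * δ + δ) ^ 2 ≤
        cutoff S (‖f z - f z₀‖ ^ 2) * δ / (‖f z - f z₀‖ ^ 2 + δ) ^ 2 := by gcongr
    calc 1 / (400 * η ^ 2) = l ^ 2 * (1 / 4 * δ / (9 * δ + δ) ^ 2) := by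
          rw [hδ]
          field_simp
          norm_num
      _ ≤ M z := mul_le_mul b1.le hfrac (by positivity) (gradSq_nonneg z)
  have hsub : Icc (t₀ - η) (t₀ + η) ×ˢ Icc (θ₀ - η) (θ₀ + η) ⊆ Icc a b ×ˢ Icc 0 (2 * π) :=
    fun z hz => prod_mono Ioo_subset_Icc_self Ioo_subset_Icc_self (hball (hlt z hz)).2.2.2
  have hint : ∀ s t s' t' : ℝ, IntegrableOn M (Icc s t ×ˢ Icc s' t') := fun _ _ _ _ =>
    cM.continuousOn.integrableOn_compact (isCompact_Icc.prod isCompact_Icc)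
  have hM0 : ∀ z, 0 ≤ M z := fun z =>
    mul_nonneg (gradSq_nonneg z) (div_nonneg (mul_nonneg cutoff_nonneg hδpos.le) (sq_nonneg _))
  calc (1:ℝ) / 100 = ∫ _z in Icc (t₀ - η) (t₀ + η) ×ˢ Icc (θ₀ - η) (θ₀ + η),
        1 / (400 * η ^ 2) := by
        rw [setIntegral_const, Measure.volume_eq_prod, measureReal_prod_prod,
          Real.volume_real_Icc_of_le (by linarith), Real.volume_real_Icc_of_le (by linarith),
          smul_eq_mul]
        field_simp
        ring
    _ ≤ ∫ z in Icc (t₀ - η) (t₀ + η) ×ˢ Icc (θ₀ - η) (θ₀ + η), M z :=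
        setIntegral_mono_on (integrableOn_const (isCompact_Icc.prod isCompact_Icc).measure_ne_top)
          (hint _ _ _ _) (measurableSet_Icc.prod measurableSet_Icc) hlow
    _ ≤ ∫ z in Icc a b ×ˢ Icc 0 (2 * π), M z :=
        setIntegral_mono_set (hint _ _ _ _) (Eventually.of_forall hM0) hsub.eventuallyLE

/-- Simon's monotonicity formula: the image of an interior point is at distance at most a constant
times the square root of the energy from the image of the boundary, up to a Willmore term. -/
theorem monotonicity {a b : ℝ} {z₀ : ℝ × ℝ} (hz₀ : z₀ ∈ Ioo a b ×ˢ Ioo 0 (2 * π))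
    (hg : gradSq f z₀ ≠ 0) {S : ℝ} (hS : 0 < S) (ha : ∀ θ, S ≤ ‖f (a, θ) - f z₀‖ ^ 2)
    (hb : ∀ θ, S ≤ ‖f (b, θ) - f z₀‖ ^ 2)
    (hw : IntegrableOn (fun z => ‖lap f z‖ ^ 2 / gradSq f z) (Icc a b ×ˢ Icc 0 (2 * π))) :
    1 / 100 ≤ 2 / S * (∫ z in Icc a b ×ˢ Icc 0 (2 * π), gradSq f z) +
        1 / 4 * ∫ z in Icc a b ×ˢ Icc 0 (2 * π), ‖lap f z‖ ^ 2 / gradSq f z := by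
  obtain ⟨δ, hδ, h⟩ := hf.exists_weighted_area_ge hz₀ hg hS
  exact h.trans (hf.weighted_area_le (f z₀) (hz₀.1.1.trans hz₀.1.2).le hS hδ ha hb hw)

end IsConformalCylinder

/-- The energy `∫ |∇f|² dθ` on the circle at height `t`. -/
noncomputable def circleEnergy {n : ℕ} (f : ℝ × ℝ → EuclideanSpace ℝ (Fin n)) (t : ℝ) : ℝ :=
  ∫ θ in (0:ℝ)..2 * π, gradSq f (t, θ)

/-- The mean value of `f` on the circle at height `t`. -/
noncomputable def circleMean {n : ℕ} (f : ℝ × ℝ → EuclideanSpace ℝ (Fin n)) (t : ℝ) :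
    EuclideanSpace ℝ (Fin n) := (2 * π)⁻¹ • ∫ θ in (0:ℝ)..2 * π, f (t, θ)

theorem circleEnergy_nonneg {n : ℕ} {f : ℝ × ℝ → EuclideanSpace ℝ (Fin n)} (t : ℝ) :
    0 ≤ circleEnergy f t :=
  intervalIntegral.integral_nonneg (by positivity) fun _ _ => gradSq_nonneg _

namespace IsConformalCylinder

variable {n : ℕ} {f : ℝ × ℝ → EuclideanSpace ℝ (Fin n)} (hf : IsConformalCylinder f)
include hf

theorem continuous_circleEnergy : Continuous (circleEnergy f) := by
  have := hf.continuous_gradSq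
  unfold circleEnergy
  fun_prop

theorem integral_norm_pd2_sq (t : ℝ) :
    ∫ θ in (0:ℝ)..2 * π, ‖pd2 f (t, θ)‖ ^ 2 = circleEnergy f t / 2 := by
  simp_rw [circleEnergy, hf.gradSq_eq]
  rw [intervalIntegral.integral_const_mul]
  ring

theorem integral_norm_pd1_sq (t : ℝ) :
    ∫ θ in (0:ℝ)..2 * π, ‖pd1 f (t, θ)‖ ^ 2 = circleEnergy f t / 2 := by
  simp_rw [fun z => (hf.conformal z).1]
  exact hf.integral_norm_pd2_sq t

theorem hasDerivAt_circleMean (t : ℝ) :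
    HasDerivAt (circleMean f) ((2 * π)⁻¹ • ∫ θ in (0:ℝ)..2 * π, pd1 f (t, θ)) t :=
  (hasDerivAt_parametric_intervalIntegral hf.smooth.continuous hf.continuous_pd1
    (hasDerivAt_pd1 hf.smooth) 0 (2 * π) t).fun_const_smul (2 * π)⁻¹

theorem continuous_circleMean : Continuous (circleMean f) :=
  continuous_iff_continuousAt.2 fun t => (hf.hasDerivAt_circleMean t).continuousAt

theorem norm_sub_circleMean_sq_le_circleEnergy (t θ : ℝ) :
    ‖f (t, θ) - circleMean f t‖ ^ 2 ≤ π * circleEnergy f t := by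
  have cf := hf.smooth.continuous
  have c2 := hf.continuous_pd2
  have hpi : (0:ℝ) < 2 * π := by positivity
  obtain ⟨θ₁, hθ₁, he⟩ :=
    Function.Periodic.exists_mem_Ico₀ (f := fun θ => f (t, θ)) (hf.periodic t) hpi θ
  rw [he]
  set L := ∫ x in (0:ℝ)..2 * π, ‖pd2 f (t, x)‖ with hL
  have hL2 : L ^ 2 ≤ π * circleEnergy f t := by
    refine (sq_integral_le (p := fun x => ‖pd2 f (t, x)‖) (by fun_prop) hpi.le).trans_eq ?_
    rw [hf.integral_norm_pd2_sq]
    ring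
  have hosc : ∀ x ∈ Icc 0 (2 * π), ‖f (t, θ₁) - f (t, x)‖ ≤ L := fun x hx => by
    rw [← intervalIntegral.integral_eq_sub_of_hasDerivAt
      (fun y _ => hasDerivAt_pd2 hf.smooth t y)
      (Continuous.intervalIntegrable (by fun_prop) _ _)]
    refine intervalIntegral.norm_integral_le_integral_norm_uIoc.trans ?_
    rw [hL, intervalIntegral.integral_of_le hpi.le]
    refine setIntegral_mono_set (Continuous.integrableOn_Ioc (by fun_prop))
      (Eventually.of_forall fun _ => norm_nonneg _) (LE.le.eventuallyLE ?_)
    exact Ioc_subset_Ioc (le_min hx.1 hθ₁.1) (max_le hx.2 hθ₁.2.le)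
  have hmean : f (t, θ₁) - circleMean f t =
      (2 * π)⁻¹ • ∫ x in (0:ℝ)..2 * π, (f (t, θ₁) - f (t, x)) := by
    rw [intervalIntegral.integral_sub intervalIntegrable_const
      (Continuous.intervalIntegrable (by fun_prop) _ _), intervalIntegral.integral_const,
      smul_sub, sub_zero, inv_smul_smul₀ hpi.ne', circleMean]
  have hnorm : ‖f (t, θ₁) - circleMean f t‖ ≤ L := by
    rw [hmean, norm_smul, norm_inv, Real.norm_of_nonneg hpi.le, inv_mul_le_iff₀ hpi, mul_comm (2 * π) L]
    refine (intervalIntegral.norm_integral_le_of_norm_le_const fun x hx => hosc x ?_).trans_eq ?_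
    · rw [uIoc_of_le hpi.le] at hx
      exact Ioc_subset_Icc_self hx
    · rw [sub_zero, abs_of_pos hpi]
  exact (pow_le_pow_left₀ (norm_nonneg _) hnorm 2).trans hL2

theorem norm_integral_pd1_sq_le (t : ℝ) :
    (2 * π)⁻¹ * ‖∫ θ in (0:ℝ)..2 * π, pd1 f (t, θ)‖ ^ 2 ≤ circleEnergy f t / 2 := by
  have c1 := hf.continuous_pd1
  have hpi : (0:ℝ) < 2 * π := by positivity
  rw [inv_mul_le_iff₀ hpi]
  refine (pow_le_pow_left₀ (norm_nonneg _)
    (intervalIntegral.norm_integral_le_integral_norm hpi.le) 2).trans ?_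
  refine (sq_integral_le (p := fun x => ‖pd1 f (t, x)‖) (by fun_prop) hpi.le).trans_eq ?_
  rw [hf.integral_norm_pd1_sq, sub_zero]

theorem norm_circleMean_sub_sq_le {x y : ℝ} (hxy : x ≤ y) (hy : y ≤ x + 1) :
    ‖circleMean f y - circleMean f x‖ ^ 2 ≤ ∫ t in x..y, circleEnergy f t := by
  have c1 := hf.continuous_pd1
  have hpi : (0:ℝ) < 2 * π := by positivity
  have cG := hf.continuous_circleEnergy
  set m' : ℝ → EuclideanSpace ℝ (Fin n) := fun t =>
    (2 * π)⁻¹ • ∫ θ in (0:ℝ)..2 * π, pd1 f (t, θ) with hm'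
  have cm' : Continuous m' := by fun_prop
  have hm'G : ∀ t, ‖m' t‖ ^ 2 ≤ circleEnergy f t := fun t => by
    rw [hm', norm_smul, norm_inv, Real.norm_of_nonneg hpi.le, mul_pow, sq (2 * π)⁻¹, mul_assoc]
    have h1 := hf.norm_integral_pd1_sq_le t
    have h2 : (2 * π)⁻¹ ≤ 1 := inv_le_one_of_one_le₀ (by linarith [Real.pi_gt_three])
    have h3 := circleEnergy_nonneg (f := f) t
    refine (mul_le_of_le_one_left (by positivity) h2).trans ?_
    linarith
  rw [← intervalIntegral.integral_eq_sub_of_hasDerivAt (fun t _ => hf.hasDerivAt_circleMean t)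
    (cm'.intervalIntegrable _ _)]
  calc ‖∫ t in x..y, m' t‖ ^ 2 ≤ (∫ t in x..y, ‖m' t‖) ^ 2 := by
        gcongr
        exact intervalIntegral.norm_integral_le_integral_norm hxy
    _ ≤ (y - x) * ∫ t in x..y, ‖m' t‖ ^ 2 := sq_integral_le (by fun_prop) hxy
    _ ≤ 1 * ∫ t in x..y, circleEnergy f t := by
        have h0 : 0 ≤ ∫ t in x..y, ‖m' t‖ ^ 2 :=
          intervalIntegral.integral_nonneg hxy fun _ _ => sq_nonneg _
        refine mul_le_mul (by linarith) ?_ h0 zero_le_one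
        exact intervalIntegral.integral_mono_on hxy
          (Continuous.intervalIntegrable (by fun_prop) _ _) (cG.intervalIntegrable _ _)
          fun t _ => hm'G t
    _ = _ := one_mul _

theorem integral_circleEnergy_mono {a b c d : ℝ} (hca : c ≤ a) (hab : a ≤ b) (hbd : b ≤ d) :
    ∫ t in a..b, circleEnergy f t ≤ ∫ t in c..d, circleEnergy f t :=
  intervalIntegral.integral_mono_interval hca hab hbd
    (Eventually.of_forall fun t => circleEnergy_nonneg t)
    (hf.continuous_circleEnergy.intervalIntegrable _ _)

theorem exists_boundary_near {τ θ : ℝ} (hθ : θ ∈ Ioo 0 (2 * π)) (hg : gradSq f (τ, θ) ≠ 0)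
    (hw : IntegrableOn (fun z => ‖lap f z‖ ^ 2 / gradSq f z)
      (Icc (τ - 1) (τ + 1) ×ˢ Icc 0 (2 * π)))
    (hW : ∫ z in Icc (τ - 1) (τ + 1) ×ˢ Icc 0 (2 * π), ‖lap f z‖ ^ 2 / gradSq f z ≤ 1 / 50)
    {a b : ℝ} (ha : a ∈ Icc (τ - 1) τ) (hb : b ∈ Icc τ (τ + 1)) :
    ∃ s, (s = a ∨ s = b) ∧ ∃ φ,
      ‖f (s, φ) - f (τ, θ)‖ ^ 2 ≤ 500 * ∫ t in τ - 1..τ + 1, circleEnergy f t := by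
  have cg := hf.continuous_gradSq
  set e := ∫ t in τ - 1..τ + 1, circleEnergy f t with he
  have hG : 0 < circleEnergy f τ :=
    intervalIntegral.integral_pos (by positivity) (Continuous.continuousOn (by fun_prop))
      (fun _ _ => gradSq_nonneg _)
      ⟨θ, Ioo_subset_Icc_self hθ, lt_of_le_of_ne (gradSq_nonneg _) hg.symm⟩
  have hepos : 0 < e :=
    intervalIntegral.integral_pos (by linarith) hf.continuous_circleEnergy.continuousOn
      (fun _ _ => circleEnergy_nonneg _) ⟨τ, ⟨by linarith, by linarith⟩, hG⟩
  by_contra! hcon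
  have hne : ∀ s, (s = a ∨ s = b) → s ≠ τ := fun s hs h => by
    have := hcon s hs θ
    rw [h] at this
    simp only [sub_self, norm_zero, ne_eq, OfNat.ofNat_ne_zero, not_false_eq_true, zero_pow] at this
    linarith
  have haτ : a < τ := lt_of_le_of_ne ha.2 (hne a (Or.inl rfl))
  have hτb : τ < b := lt_of_le_of_ne hb.1 (hne b (Or.inr rfl)).symm
  have hsub : Icc a b ×ˢ Icc 0 (2 * π) ⊆ Icc (τ - 1) (τ + 1) ×ˢ Icc 0 (2 * π) :=
    prod_mono (Icc_subset_Icc ha.1 hb.2) subset_rfl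
  have key := hf.monotonicity (z₀ := (τ, θ)) ⟨⟨haτ, hτb⟩, hθ⟩ hg
    (by positivity : 0 < 500 * e) (fun φ => (hcon a (Or.inl rfl) φ).le)
    (fun φ => (hcon b (Or.inr rfl) φ).le) (hw.mono_set hsub)
  have h1 : ∫ z in Icc a b ×ˢ Icc 0 (2 * π), gradSq f z ≤ e := by
    rw [setIntegral_Icc_prod_Icc cg (by linarith) (by positivity)]
    exact hf.integral_circleEnergy_mono ha.1 (by linarith) hb.2
  have h2 : ∫ z in Icc a b ×ˢ Icc 0 (2 * π), ‖lap f z‖ ^ 2 / gradSq f z ≤ 1 / 50 :=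
    (setIntegral_mono_set hw (Eventually.of_forall fun z =>
      div_nonneg (sq_nonneg _) (gradSq_nonneg z)) hsub.eventuallyLE).trans hW
  have h3 : 2 / (500 * e) * (∫ z in Icc a b ×ˢ Icc 0 (2 * π), gradSq f z) ≤
      2 / (500 * e) * e := by gcongr
  have h4 : 2 / (500 * e) * e = 1 / 250 := by field_simp; norm_num
  linarith

/-- A sup bound for the oscillation of `f` on a circle by the energy of a neighbouring cylinder. -/
theorem norm_sub_circleMean_sq_le {τ θ : ℝ} (hθ : θ ∈ Ioo 0 (2 * π)) (hg : gradSq f (τ, θ) ≠ 0)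
    (hw : IntegrableOn (fun z => ‖lap f z‖ ^ 2 / gradSq f z)
      (Icc (τ - 1) (τ + 1) ×ˢ Icc 0 (2 * π)))
    (hW : ∫ z in Icc (τ - 1) (τ + 1) ×ˢ Icc 0 (2 * π), ‖lap f z‖ ^ 2 / gradSq f z ≤ 1 / 50) :
    ‖f (τ, θ) - circleMean f τ‖ ^ 2 ≤ 1600 * ∫ t in τ - 1..τ + 1, circleEnergy f t := by
  have cG := hf.continuous_circleEnergy
  obtain ⟨a, ha, hGa⟩ := exists_le_intervalIntegral cG (τ - 1)
  obtain ⟨b, hb, hGb⟩ := exists_le_intervalIntegral cG τ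
  rw [sub_add_cancel] at ha hGa
  obtain ⟨s, hs, φ, hφ⟩ := hf.exists_boundary_near hθ hg hw hW ha hb
  set e := ∫ t in τ - 1..τ + 1, circleEnergy f t with he
  have hGs : circleEnergy f s ≤ e := by
    rcases hs with rfl | rfl
    · exact hGa.trans (hf.integral_circleEnergy_mono le_rfl (by linarith) (by linarith))
    · exact hGb.trans (hf.integral_circleEnergy_mono (by linarith) (by linarith) le_rfl)
  have hmean : ‖circleMean f s - circleMean f τ‖ ^ 2 ≤ e := by
    rcases hs with rfl | rfl
    · rw [norm_sub_rev]
      exact (hf.norm_circleMean_sub_sq_le ha.2 (by linarith [ha.1])).trans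
        (hf.integral_circleEnergy_mono ha.1 ha.2 (by linarith))
    · exact (hf.norm_circleMean_sub_sq_le hb.1 hb.2).trans
        (hf.integral_circleEnergy_mono (by linarith) hb.1 hb.2)
  have hosc := hf.norm_sub_circleMean_sq_le_circleEnergy s φ
  have he0 : 0 ≤ e := (circleEnergy_nonneg s).trans hGs
  have htri : ‖f (τ, θ) - circleMean f τ‖ ≤ ‖f (s, φ) - f (τ, θ)‖ +
      ‖f (s, φ) - circleMean f s‖ + ‖circleMean f s - circleMean f τ‖ := by
    have : f (τ, θ) - circleMean f τ = -(f (s, φ) - f (τ, θ)) + (f (s, φ) - circleMean f s) +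
      (circleMean f s - circleMean f τ) := by abel
    rw [this]
    refine (norm_add₃_le).trans ?_
    rw [norm_neg]
  have hpi := Real.pi_lt_four
  have h1 : π * circleEnergy f s ≤ 4 * e :=
    mul_le_mul hpi.le hGs (circleEnergy_nonneg s) (by norm_num)
  have h2 := pow_le_pow_left₀ (norm_nonneg _) htri 2
  nlinarith [sq_nonneg (‖f (s, φ) - f (τ, θ)‖ - ‖f (s, φ) - circleMean f s‖),
    sq_nonneg (‖f (s, φ) - f (τ, θ)‖ - ‖circleMean f s - circleMean f τ‖),
    sq_nonneg (‖f (s, φ) - circleMean f s‖ - ‖circleMean f s - circleMean f τ‖)]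

end IsConformalCylinder

/-- The flux `∫ ⟪f - f̄, ∂_t f⟫ dθ` through the circle at height `t`. -/
noncomputable def circleFlux {n : ℕ} (f : ℝ × ℝ → EuclideanSpace ℝ (Fin n)) (t : ℝ) : ℝ :=
  ∫ θ in (0:ℝ)..2 * π, ⟪f (t, θ) - circleMean f t, pd1 f (t, θ)⟫

namespace IsConformalCylinder

variable {n : ℕ} {f : ℝ × ℝ → EuclideanSpace ℝ (Fin n)} (hf : IsConformalCylinder f)
include hf

theorem abs_circleFlux_le (t : ℝ) : |circleFlux f t| ≤ circleEnergy f t / 2 := by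
  have cf := hf.smooth.continuous
  have c1 := hf.continuous_pd1
  have c2 := hf.continuous_pd2
  have hpi : (0:ℝ) ≤ 2 * π := by positivity
  have hW := wirtinger_euclidean (fun θ => hasDerivAt_pd2 hf.smooth t θ) (by fun_prop)
    (hf.eq_two_pi t)
  rw [hf.integral_norm_pd2_sq] at hW
  calc |circleFlux f t|
      ≤ ∫ θ in (0:ℝ)..2 * π, |⟪f (t, θ) - circleMean f t, pd1 f (t, θ)⟫| :=
        intervalIntegral.abs_integral_le_integral_abs hpi
    _ ≤ ∫ θ in (0:ℝ)..2 * π,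
          (‖f (t, θ) - circleMean f t‖ ^ 2 + ‖pd1 f (t, θ)‖ ^ 2) / 2 := by
        refine intervalIntegral.integral_mono_on hpi
          (Continuous.intervalIntegrable (by fun_prop) _ _)
          (Continuous.intervalIntegrable (by fun_prop) _ _) fun θ _ => ?_
        have h1 := abs_real_inner_le_norm (f (t, θ) - circleMean f t) (pd1 f (t, θ))
        nlinarith [sq_nonneg (‖f (t, θ) - circleMean f t‖ - ‖pd1 f (t, θ)‖)]
    _ = ((∫ θ in (0:ℝ)..2 * π, ‖f (t, θ) - circleMean f t‖ ^ 2) + circleEnergy f t / 2) / 2 := by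
        rw [intervalIntegral.integral_div, intervalIntegral.integral_add,
          hf.integral_norm_pd1_sq]
        all_goals exact Continuous.intervalIntegrable (by fun_prop) _ _
    _ ≤ (circleEnergy f t / 2 + circleEnergy f t / 2) / 2 := by
        gcongr
        exact hW
    _ = _ := by ring

theorem integral_pd2_pd2 (t : ℝ) : ∫ θ in (0:ℝ)..2 * π, pd2 (pd2 f) (t, θ) = 0 := by
  have c22 := hf.smooth.pd2.pd2.continuous
  rw [intervalIntegral.integral_eq_sub_of_hasDerivAt
    (fun θ _ => hasDerivAt_pd2 hf.smooth.pd2 t θ)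
    (Continuous.intervalIntegrable (by fun_prop) _ _), sub_eq_zero]
  simpa using hf.pd2_periodic t 0

theorem integral_inner_pd2_pd2 (t : ℝ) :
    ∫ θ in (0:ℝ)..2 * π, ⟪f (t, θ), pd2 (pd2 f) (t, θ)⟫ = -(circleEnergy f t / 2) := by
  have cf := hf.smooth.continuous
  have c2 := hf.continuous_pd2
  have c22 := hf.smooth.pd2.pd2.continuous
  have h : ∫ θ in (0:ℝ)..2 * π,
      (⟪f (t, θ), pd2 (pd2 f) (t, θ)⟫ + ⟪pd2 f (t, θ), pd2 f (t, θ)⟫) = 0 := by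
    rw [intervalIntegral.integral_eq_sub_of_hasDerivAt
      (fun θ _ => (hasDerivAt_pd2 hf.smooth t θ).inner ℝ (hasDerivAt_pd2 hf.smooth.pd2 t θ))
      (Continuous.intervalIntegrable (by fun_prop) _ _), hf.eq_two_pi, sub_eq_zero]
    simpa using congrArg (fun v => ⟪f (t, 0), v⟫) (hf.pd2_periodic t 0)
  rw [intervalIntegral.integral_add (Continuous.intervalIntegrable (by fun_prop) _ _)
    (Continuous.intervalIntegrable (by fun_prop) _ _)] at h
  simp_rw [real_inner_self_eq_norm_sq, hf.integral_norm_pd2_sq] at h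
  linarith

theorem circleFlux_eq (t : ℝ) : circleFlux f t =
    (∫ θ in (0:ℝ)..2 * π, ⟪f (t, θ), pd1 f (t, θ)⟫) -
      ⟪circleMean f t, ∫ θ in (0:ℝ)..2 * π, pd1 f (t, θ)⟫ := by
  have cf := hf.smooth.continuous
  have c1 := hf.continuous_pd1
  simp_rw [circleFlux, inner_sub_left]
  rw [intervalIntegral.integral_sub (Continuous.intervalIntegrable (by fun_prop) _ _)
    (Continuous.intervalIntegrable (by fun_prop) _ _)]
  congr 1
  exact (innerSL ℝ (circleMean f t)).intervalIntegral_comp_comm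
    (Continuous.intervalIntegrable (by fun_prop) _ _)

theorem hasDerivAt_circleFlux (t : ℝ) : HasDerivAt (circleFlux f)
    (circleEnergy f t - (2 * π)⁻¹ * ‖∫ θ in (0:ℝ)..2 * π, pd1 f (t, θ)‖ ^ 2 +
      ∫ θ in (0:ℝ)..2 * π, ⟪f (t, θ) - circleMean f t, lap f (t, θ)⟫) t := by
  have cf := hf.smooth.continuous
  have c1 := hf.continuous_pd1
  have c11 := hf.smooth.pd1.pd1.continuous
  have c22 := hf.smooth.pd2.pd2.continuous
  have hA := hasDerivAt_parametric_intervalIntegral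
    (F := fun z => ⟪f z, pd1 f z⟫)
    (F' := fun z => ⟪f z, pd1 (pd1 f) z⟫ + ⟪pd1 f z, pd1 f z⟫) (by fun_prop) (by fun_prop)
    (fun t θ => (hasDerivAt_pd1 hf.smooth t θ).inner ℝ (hasDerivAt_pd1 hf.smooth.pd1 t θ))
    0 (2 * π) t
  have hB := (hf.hasDerivAt_circleMean t).inner ℝ
    (hasDerivAt_parametric_intervalIntegral c1 c11 (hasDerivAt_pd1 hf.smooth.pd1) 0 (2 * π) t)
  rw [funext hf.circleFlux_eq]
  refine (hA.sub hB).congr_deriv ?_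
  have e1 : ∫ θ in (0:ℝ)..2 * π,
      (⟪f (t, θ), pd1 (pd1 f) (t, θ)⟫ + ⟪pd1 f (t, θ), pd1 f (t, θ)⟫) =
      (∫ θ in (0:ℝ)..2 * π, ⟪f (t, θ), pd1 (pd1 f) (t, θ)⟫) + circleEnergy f t / 2 := by
    rw [intervalIntegral.integral_add (Continuous.intervalIntegrable (by fun_prop) _ _)
      (Continuous.intervalIntegrable (by fun_prop) _ _)]
    simp_rw [real_inner_self_eq_norm_sq, hf.integral_norm_pd1_sq]
  have e2 : ∫ θ in (0:ℝ)..2 * π, ⟪f (t, θ) - circleMean f t, lap f (t, θ)⟫ =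
      (∫ θ in (0:ℝ)..2 * π, ⟪f (t, θ), pd1 (pd1 f) (t, θ)⟫) - circleEnergy f t / 2 -
        ⟪circleMean f t, ∫ θ in (0:ℝ)..2 * π, pd1 (pd1 f) (t, θ)⟫ := by
    have hmean : ⟪circleMean f t, ∫ θ in (0:ℝ)..2 * π, pd1 (pd1 f) (t, θ)⟫ =
        ∫ θ in (0:ℝ)..2 * π, ⟪circleMean f t, lap f (t, θ)⟫ := by
      have h0 : ∫ θ in (0:ℝ)..2 * π, lap f (t, θ) =
          ∫ θ in (0:ℝ)..2 * π, pd1 (pd1 f) (t, θ) := by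
        simp_rw [lap]
        rw [intervalIntegral.integral_add (Continuous.intervalIntegrable (by fun_prop) _ _)
          (Continuous.intervalIntegrable (by fun_prop) _ _), hf.integral_pd2_pd2, add_zero]
      rw [← h0]
      have cl := hf.continuous_lap
      exact ((innerSL ℝ (circleMean f t)).intervalIntegral_comp_comm
        (Continuous.intervalIntegrable (by fun_prop) _ _)).symm
    have cl := hf.continuous_lap
    simp_rw [inner_sub_left]
    rw [intervalIntegral.integral_sub (Continuous.intervalIntegrable (by fun_prop) _ _)
      (Continuous.intervalIntegrable (by fun_prop) _ _), hmean]
    congr 1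
    simp_rw [lap, inner_add_right]
    rw [intervalIntegral.integral_add (Continuous.intervalIntegrable (by fun_prop) _ _)
      (Continuous.intervalIntegrable (by fun_prop) _ _), hf.integral_inner_pd2_pd2]
    ring
  rw [e1, e2, real_inner_smul_left, real_inner_self_eq_norm_sq]
  ring

/-- The energy of a cylinder is controlled by the energy of its boundary circles, up to an error
involving the Laplacian. -/
theorem integral_circleEnergy_le {t : ℝ} (ht : 0 ≤ t) :
    ∫ τ in -t..t, circleEnergy f τ ≤ circleEnergy f t + circleEnergy f (-t) +
      2 * ∫ τ in -t..t, ∫ θ in (0:ℝ)..2 * π,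
        |⟪f (τ, θ) - circleMean f τ, lap f (τ, θ)⟫| := by
  have cf := hf.smooth.continuous
  have c1 := hf.continuous_pd1
  have cl := hf.continuous_lap
  have cm := hf.continuous_circleMean
  have cG := hf.continuous_circleEnergy
  have hpi : (0:ℝ) < 2 * π := by positivity
  have htt : -t ≤ t := by linarith
  have key := intervalIntegral.integral_eq_sub_of_hasDerivAt
    (fun τ (_ : τ ∈ uIcc (-t) t) => hf.hasDerivAt_circleFlux τ)
    (Continuous.intervalIntegrable (by fun_prop) _ _)
  have hmono : ∫ τ in -t..t, (circleEnergy f τ / 2 - ∫ θ in (0:ℝ)..2 * π,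
        |⟪f (τ, θ) - circleMean f τ, lap f (τ, θ)⟫|) ≤ circleFlux f t - circleFlux f (-t) := by
    rw [← key]
    refine intervalIntegral.integral_mono_on htt
      (Continuous.intervalIntegrable (by fun_prop) _ _)
      (Continuous.intervalIntegrable (by fun_prop) _ _) fun τ _ => ?_
    have h1 := hf.norm_integral_pd1_sq_le τ
    have h2 := neg_le_of_abs_le (intervalIntegral.abs_integral_le_integral_abs
      (f := fun θ => ⟪f (τ, θ) - circleMean f τ, lap f (τ, θ)⟫) (μ := volume) hpi.le)
    linarith
  rw [intervalIntegral.integral_sub (Continuous.intervalIntegrable (by fun_prop) _ _)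
    (Continuous.intervalIntegrable (by fun_prop) _ _), intervalIntegral.integral_div] at hmono
  have h1 := le_of_abs_le (hf.abs_circleFlux_le t)
  have h2 := neg_le_of_abs_le (hf.abs_circleFlux_le (-t))
  linarith

end IsConformalCylinder

theorem ofReal_intervalIntegral {u : ℝ → ℝ} (hu : Continuous u) (h0 : ∀ x, 0 ≤ u x) {a b : ℝ}
    (hab : a ≤ b) : ENNReal.ofReal (∫ x in a..b, u x) = ∫⁻ x in Icc a b, ENNReal.ofReal (u x) := by
  rw [intervalIntegral.integral_of_le hab, ← integral_Icc_eq_integral_Ioc]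
  exact ofReal_integral_eq_lintegral_ofReal hu.continuousOn.integrableOn_Icc
    (Eventually.of_forall h0)

theorem lintegral_window_le {h : ℝ → ℝ≥0∞} {T t : ℝ} {δ : ℝ≥0∞} (hT : 1 ≤ 2 * T) (htT : t ≤ T)
    (hδ : ∀ s ∈ Icc (-T) (T - 1), ∫⁻ τ in Icc s (s + 1), h τ ≤ δ) (σ : ℝ) :
    ∫⁻ τ in Icc (σ - 1) (σ + 1) ∩ Icc (-t) t, h τ ≤ 2 * δ := by
  have hclamp : ∀ x, max (-T) (min x (T - 1)) ∈ Icc (-T) (T - 1) := fun x =>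
    ⟨le_max_left _ _, max_le (by linarith) (min_le_right _ _)⟩
  refine (lintegral_mono_set (t := Icc (max (-T) (min (σ - 1) (T - 1)))
    (max (-T) (min (σ - 1) (T - 1)) + 1) ∪ Icc (max (-T) (min σ (T - 1)))
    (max (-T) (min σ (T - 1)) + 1)) ?_).trans ((lintegral_union_le _ _ _).trans ?_)
  · rintro τ ⟨⟨hσ₁, hσ₂⟩, hτ₁, hτ₂⟩
    rcases le_total τ σ with hc | hc
    · refine Or.inl ⟨max_le (by linarith) ((min_le_left _ _).trans hσ₁), ?_⟩
      have h1 : τ - 1 ≤ min (σ - 1) (T - 1) := le_min (by linarith) (by linarith)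
      linarith [le_max_right (-T) (min (σ - 1) (T - 1))]
    · refine Or.inr ⟨max_le (by linarith) ((min_le_left _ _).trans hc), ?_⟩
      have h1 : τ - 1 ≤ min σ (T - 1) := le_min (by linarith) (by linarith)
      linarith [le_max_right (-T) (min σ (T - 1))]
  · rw [two_mul]
    exact add_le_add (hδ _ (hclamp _)) (hδ _ (hclamp _))

theorem lintegral_mul_window_le {G h : ℝ → ℝ≥0∞} (hG : Measurable G) (hh : Measurable h)
    {T t : ℝ} {δ : ℝ≥0∞} (hT : 1 ≤ 2 * T) (htT : t ≤ T)
    (hδ : ∀ s ∈ Icc (-T) (T - 1), ∫⁻ τ in Icc s (s + 1), h τ ≤ δ) :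
    ∫⁻ τ in Icc (-t) t, (∫⁻ σ in Icc (τ - 1) (τ + 1), G σ) * h τ ≤
      2 * δ * ∫⁻ σ in Icc (-(t + 1)) (t + 1), G σ := by
  set D : Set (ℝ × ℝ) := {p | p.1 ∈ Icc (p.2 - 1) (p.2 + 1)} with hD
  have hDm : MeasurableSet D := by
    exact (measurableSet_le (f := fun p : ℝ × ℝ => p.2 - 1) (by fun_prop) measurable_fst).inter
      (measurableSet_le (g := fun p : ℝ × ℝ => p.2 + 1) measurable_fst (by fun_prop))
  set K : ℝ → ℝ → ℝ≥0∞ := fun τ σ => D.indicator (fun p => G p.2 * h p.1) (τ, σ) with hK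
  have hKm : Measurable (Function.uncurry K) :=
    Measurable.indicator (by fun_prop) hDm
  have hleft : ∀ τ ∈ Icc (-t) t, (∫⁻ σ in Icc (τ - 1) (τ + 1), G σ) * h τ ≤
      ∫⁻ σ in Icc (-(t + 1)) (t + 1), K τ σ := fun τ hτ => by
    rw [← lintegral_mul_const _ hG]
    refine (setLIntegral_mono' measurableSet_Icc fun σ hσ => ?_).trans
      (lintegral_mono_set (Icc_subset_Icc (by linarith [hτ.1]) (by linarith [hτ.2])))
    have : (τ, σ) ∈ D := ⟨by simp only; linarith [hσ.2], by simp only; linarith [hσ.1]⟩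
    rw [hK]
    simp only [indicator_of_mem this, le_refl]
  have hright : ∀ σ, ∫⁻ τ in Icc (-t) t, K τ σ ≤ 2 * δ * G σ := fun σ => by
    have hKσ : ∀ τ, K τ σ = G σ * (Icc (σ - 1) (σ + 1)).indicator h τ := fun τ => by
      by_cases hτ : τ ∈ Icc (σ - 1) (σ + 1)
      · have : (τ, σ) ∈ D := hτ
        simp only [hK, indicator_of_mem this, indicator_of_mem hτ]
      · have : (τ, σ) ∉ D := hτ
        simp only [hK, indicator_of_notMem this, indicator_of_notMem hτ, mul_zero]
    simp_rw [hKσ]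
    rw [lintegral_const_mul _ (hh.indicator measurableSet_Icc),
      setLIntegral_indicator measurableSet_Icc, mul_comm]
    gcongr
    exact lintegral_window_le hT htT hδ σ
  calc _ ≤ ∫⁻ τ in Icc (-t) t, ∫⁻ σ in Icc (-(t + 1)) (t + 1), K τ σ :=
        setLIntegral_mono' measurableSet_Icc hleft
    _ = ∫⁻ σ in Icc (-(t + 1)) (t + 1), ∫⁻ τ in Icc (-t) t, K τ σ :=
        lintegral_lintegral_swap hKm.aemeasurable
    _ ≤ ∫⁻ σ in Icc (-(t + 1)) (t + 1), 2 * δ * G σ := lintegral_mono fun σ => hright σ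
    _ = _ := lintegral_const_mul _ hG

namespace IsConformalCylinder

variable {n : ℕ} {f : ℝ × ℝ → EuclideanSpace ℝ (Fin n)} (hf : IsConformalCylinder f)
include hf

theorem measurable_willmoreDensity : Measurable fun z => ‖lap f z‖ ^ 2 / gradSq f z :=
  (hf.continuous_lap.norm.pow 2).measurable.div hf.continuous_gradSq.measurable

theorem willmore_eq {Ω : Set (ℝ × ℝ)} :
    willmore f Ω = ∫⁻ z in Ω, ENNReal.ofReal (‖lap f z‖ ^ 2 / gradSq f z) := by
  have hm : MeasurableSet {w | gradSq f w ≠ 0} :=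
    (isOpen_ne_fun hf.continuous_gradSq continuous_const).measurableSet
  rw [willmore, inter_comm, ← setLIntegral_indicator hm]
  refine lintegral_congr fun z => ?_
  by_cases hz : gradSq f z = 0
  · rw [indicator_of_notMem (by simpa using hz), hz]
    simp
  · rw [indicator_of_mem (by simpa using hz)]

theorem lintegral_gradSq {a b : ℝ} (hab : a ≤ b) :
    ∫⁻ z in Icc a b ×ˢ Icc 0 (2 * π), ENNReal.ofReal (gradSq f z) =
      ENNReal.ofReal (∫ t in a..b, circleEnergy f t) := by
  simp_rw [circleEnergy]
  rw [← setIntegral_Icc_prod_Icc hf.continuous_gradSq hab (by positivity)]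
  exact (ofReal_integral_eq_lintegral_ofReal
    (hf.continuous_gradSq.continuousOn.integrableOn_compact (isCompact_Icc.prod isCompact_Icc))
    (Eventually.of_forall gradSq_nonneg)).symm

/-- The sup bound turned into a pointwise bound for the error term. -/
theorem abs_inner_lap_le {T ε τ θ : ℝ} (hε : 0 < ε) (hε' : ε ≤ 1 / 10)
    (hW : ∀ s ∈ Icc (-T) (T - 1),
      willmore f (Icc s (s + 1) ×ˢ Icc 0 (2 * π)) < ENNReal.ofReal (ε ^ 2))
    (hτ : τ ∈ Icc (-(T - 1)) (T - 1)) (hθ : θ ∈ Ioo 0 (2 * π)) :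
    |⟪f (τ, θ) - circleMean f τ, lap f (τ, θ)⟫| ≤ ε / 2 * gradSq f (τ, θ) +
      800 / ε * ((∫ t in τ - 1..τ + 1, circleEnergy f t) *
        (‖lap f (τ, θ)‖ ^ 2 / gradSq f (τ, θ))) := by
  by_cases hg : gradSq f (τ, θ) = 0
  · rw [hf.lap_eq_zero_of_gradSq_eq_zero hg, hg]
    simp
  have hlin : ∫⁻ z in Icc (τ - 1) (τ + 1) ×ˢ Icc 0 (2 * π),
      ENNReal.ofReal (‖lap f z‖ ^ 2 / gradSq f z) ≤ ENNReal.ofReal (1 / 50) := by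
    have hunion : Icc (τ - 1) (τ + 1) ×ˢ Icc 0 (2 * π) ⊆
        Icc (τ - 1) (τ - 1 + 1) ×ˢ Icc 0 (2 * π) ∪ Icc τ (τ + 1) ×ˢ Icc 0 (2 * π) := by
      rw [← union_prod, sub_add_cancel, Icc_union_Icc_eq_Icc (by linarith) (by linarith)]
    refine (lintegral_mono_set hunion).trans ((lintegral_union_le _ _ _).trans ?_)
    rw [← hf.willmore_eq, ← hf.willmore_eq]
    refine (add_le_add (hW (τ - 1) ⟨by linarith [hτ.1], by linarith [hτ.2]⟩).le
      (hW τ ⟨by linarith [hτ.1], hτ.2⟩).le).trans ?_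
    rw [← ENNReal.ofReal_add (sq_nonneg _) (sq_nonneg _)]
    exact ENNReal.ofReal_le_ofReal (by nlinarith)
  have h0 : ∀ z, 0 ≤ ‖lap f z‖ ^ 2 / gradSq f z := fun z =>
    div_nonneg (sq_nonneg _) (gradSq_nonneg z)
  have hint : IntegrableOn (fun z => ‖lap f z‖ ^ 2 / gradSq f z)
      (Icc (τ - 1) (τ + 1) ×ˢ Icc 0 (2 * π)) :=
    ⟨hf.measurable_willmoreDensity.aestronglyMeasurable,
      (hasFiniteIntegral_iff_ofReal (Eventually.of_forall h0)).2
        (hlin.trans_lt ENNReal.ofReal_lt_top)⟩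
  have hsmall : ∫ z in Icc (τ - 1) (τ + 1) ×ˢ Icc 0 (2 * π),
      ‖lap f z‖ ^ 2 / gradSq f z ≤ 1 / 50 := by
    rw [← ENNReal.ofReal_le_ofReal_iff (by norm_num),
      ofReal_integral_eq_lintegral_ofReal hint (Eventually.of_forall h0)]
    exact hlin
  have hsup := hf.norm_sub_circleMean_sq_le hθ hg hint hsmall
  set e := ∫ t in τ - 1..τ + 1, circleEnergy f t
  set w := ‖lap f (τ, θ)‖ ^ 2 / gradSq f (τ, θ) with hw
  have hw0 : 0 ≤ w := h0 _
  have hgpos := gradSq_nonneg (f := f) (τ, θ)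
  have hlw : ‖lap f (τ, θ)‖ ^ 2 = w * gradSq f (τ, θ) := by
    rw [hw]
    field_simp
  have he0 : 0 ≤ e := by nlinarith [sq_nonneg ‖f (τ, θ) - circleMean f τ‖]
  refine abs_le_of_sq_le_sq ?_ (by positivity)
  have hCS : ⟪f (τ, θ) - circleMean f τ, lap f (τ, θ)⟫ ^ 2 ≤
      1600 * e * (w * gradSq f (τ, θ)) := by
    rw [← hlw]
    calc _ ≤ (‖f (τ, θ) - circleMean f τ‖ * ‖lap f (τ, θ)‖) ^ 2 :=
          sq_le_sq' (neg_le_of_abs_le (abs_real_inner_le_norm _ _))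
            ((le_abs_self _).trans (abs_real_inner_le_norm _ _))
      _ = ‖f (τ, θ) - circleMean f τ‖ ^ 2 * ‖lap f (τ, θ)‖ ^ 2 := mul_pow _ _ _
      _ ≤ _ := by gcongr
  refine hCS.trans ?_
  have hprod : 4 * (ε / 2 * gradSq f (τ, θ)) * (800 / ε * (e * w)) =
      1600 * e * (w * gradSq f (τ, θ)) := by
    field_simp
    ring
  nlinarith [sq_nonneg (ε / 2 * gradSq f (τ, θ) - 800 / ε * (e * w))]

theorem integral_abs_inner_lap_le {T ε t : ℝ} (hε : 0 < ε) (hε' : ε ≤ 1 / 10)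
    (hW : ∀ s ∈ Icc (-T) (T - 1),
      willmore f (Icc s (s + 1) ×ˢ Icc 0 (2 * π)) < ENNReal.ofReal (ε ^ 2))
    (ht : 0 ≤ t) (htT : t ≤ T - 1) :
    ∫ τ in -t..t, ∫ θ in (0:ℝ)..2 * π, |⟪f (τ, θ) - circleMean f τ, lap f (τ, θ)⟫| ≤
      ε / 2 * (∫ τ in -t..t, circleEnergy f τ) +
        1600 * ε * ∫ τ in -(t + 1)..t + 1, circleEnergy f τ := by
  have cf := hf.smooth.continuous
  have cl := hf.continuous_lap
  have cm := hf.continuous_circleMean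
  have cG := hf.continuous_circleEnergy
  have cg := hf.continuous_gradSq
  have mw := hf.measurable_willmoreDensity
  have hpi : (0:ℝ) ≤ 2 * π := by positivity
  have hE0 : ∀ {a b : ℝ}, a ≤ b → 0 ≤ ∫ τ in a..b, circleEnergy f τ := fun hab =>
    intervalIntegral.integral_nonneg hab fun _ _ => circleEnergy_nonneg _
  set w : ℝ × ℝ → ℝ := fun z => ‖lap f z‖ ^ 2 / gradSq f z with hw
  have hw0 : ∀ z, 0 ≤ w z := fun z => div_nonneg (sq_nonneg _) (gradSq_nonneg z)
  set h : ℝ → ℝ≥0∞ := fun τ => ∫⁻ θ in Icc 0 (2 * π), ENNReal.ofReal (w (τ, θ)) with hh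
  have hhm : Measurable h :=
    mw.ennreal_ofReal.lintegral_prod_right'
  have hδ : ∀ s ∈ Icc (-T) (T - 1), ∫⁻ τ in Icc s (s + 1), h τ ≤ ENNReal.ofReal (ε ^ 2) :=
    fun s hs => by
      have := (hW s hs).le
      rwa [hf.willmore_eq, Measure.volume_eq_prod,
        setLIntegral_prod _ mw.ennreal_ofReal.aemeasurable] at this
  have hslice : ∀ τ ∈ Icc (-t) t,
      ENNReal.ofReal (∫ θ in (0:ℝ)..2 * π, |⟪f (τ, θ) - circleMean f τ, lap f (τ, θ)⟫|) ≤
        ENNReal.ofReal (ε / 2) * ENNReal.ofReal (circleEnergy f τ) + ENNReal.ofReal (800 / ε) *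
          ((∫⁻ σ in Icc (τ - 1) (τ + 1), ENNReal.ofReal (circleEnergy f σ)) * h τ) :=
    fun τ hτ => by
      rw [circleEnergy, ofReal_intervalIntegral (by fun_prop) (fun θ => gradSq_nonneg _) hpi,
        ← ofReal_intervalIntegral cG (fun _ => circleEnergy_nonneg _) (by linarith),
        ofReal_intervalIntegral (by fun_prop) (fun _ => abs_nonneg _) hpi, hh,
        ← lintegral_const_mul _ (by fun_prop), ← lintegral_const_mul _ (by fun_prop),
        ← lintegral_const_mul _ (by fun_prop), ← lintegral_add_left (by fun_prop),
        Measure.restrict_congr_set Ioo_ae_eq_Icc.symm]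
      refine setLIntegral_mono' measurableSet_Ioo fun θ hθ => ?_
      have he : 0 ≤ ∫ σ in τ - 1..τ + 1, circleEnergy f σ := hE0 (by linarith)
      have hg := gradSq_nonneg (f := f) (τ, θ)
      rw [← ENNReal.ofReal_mul (by positivity), ← ENNReal.ofReal_mul he,
        ← ENNReal.ofReal_mul (by positivity),
        ← ENNReal.ofReal_add (by positivity)
          (mul_nonneg (by positivity) (mul_nonneg he (hw0 _)))]
      exact ENNReal.ofReal_le_ofReal (hf.abs_inner_lap_le hε hε' hW
        ⟨by linarith [hτ.1], by linarith [hτ.2]⟩ hθ)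
  have hle := hE0 (by linarith : -t ≤ t)
  have hle' := hE0 (by linarith : -(t + 1) ≤ t + 1)
  rw [← ENNReal.ofReal_le_ofReal_iff (by positivity), ofReal_intervalIntegral (by fun_prop)
    (fun τ => intervalIntegral.integral_nonneg hpi fun _ _ => abs_nonneg _) (by linarith)]
  refine (setLIntegral_mono' measurableSet_Icc hslice).trans ?_
  have hGm : Measurable fun τ => ENNReal.ofReal (circleEnergy f τ) := by fun_prop
  rw [lintegral_add_left (by fun_prop), lintegral_const_mul _ hGm,
    lintegral_const_mul' _ _ ENNReal.ofReal_ne_top,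
    ← ofReal_intervalIntegral cG (fun _ => circleEnergy_nonneg _) (by linarith),
    ENNReal.ofReal_add (by positivity) (by positivity), ENNReal.ofReal_mul (by positivity)]
  gcongr
  calc _ ≤ ENNReal.ofReal (800 / ε) * (2 * ENNReal.ofReal (ε ^ 2) *
        ∫⁻ σ in Icc (-(t + 1)) (t + 1), ENNReal.ofReal (circleEnergy f σ)) := by
        gcongr
        exact lintegral_mul_window_le hGm hhm (by linarith) (by linarith) hδ
    _ = _ := by
        rw [← ofReal_intervalIntegral cG (fun _ => circleEnergy_nonneg _) (by linarith),
          ← ENNReal.ofReal_ofNat 2, ← ENNReal.ofReal_mul (by positivity),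
          ← ENNReal.ofReal_mul (by positivity), ← ENNReal.ofReal_mul (by positivity)]
        congr 1
        field_simp
        ring

end IsConformalCylinder

/-- A Grönwall estimate for a differential inequality with advanced argument. -/
theorem le_exp_mul_of_le_deriv_add_mul {E E' : ℝ → ℝ} (hE : ∀ t, HasDerivAt E (E' t) t) {T κ : ℝ}
    (hκ : 0 ≤ κ) (hmono : ∀ t ∈ Icc 0 T, E t ≤ E T) (hET : 0 ≤ E T)
    (hineq : ∀ t ∈ Icc 0 (T - 1), E t ≤ E' t + κ * E (t + 1)) {t : ℝ} (ht : t ∈ Icc 0 T) :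
    E t ≤ Real.exp 1 * Real.exp (-(1 - κ * Real.exp 1) * (T - t)) * E T := by
  set K := κ * Real.exp 1 with hK
  have hK0 : 0 ≤ K := by positivity
  set Y := Real.exp (1 - T) * E T with hY
  have hY0 : 0 ≤ Y := by positivity
  set D : ℝ → ℝ := fun t => Real.exp (-t) * E t - Y * Real.exp (K * (T - t)) with hD
  have hDd : ∀ t, HasDerivAt D (Real.exp (-t) * (E' t - E t) + K * (Y * Real.exp (K * (T - t)))) t :=
    fun t => by
      have h1 : HasDerivAt (fun t => Real.exp (-t)) (Real.exp (-t) * -1) t :=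
        (hasDerivAt_neg t).exp
      have h2 : HasDerivAt (fun t => Real.exp (K * (T - t))) (Real.exp (K * (T - t)) * (K * -1)) t :=
        (((hasDerivAt_id t).const_sub T).const_mul K).exp
      refine ((h1.mul (hE t)).sub (h2.const_mul Y)).congr_deriv ?_
      ring
  have hend : ∀ t ∈ Icc 0 T, T - 1 ≤ t → D t ≤ 0 := fun t ht htT => by
    have h1 : Real.exp (-t) * E t ≤ Y :=
      (mul_le_mul_of_nonneg_left (hmono t ht) (Real.exp_pos _).le).trans
        (mul_le_mul_of_nonneg_right (Real.exp_le_exp.2 (by linarith)) hET)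
    have h2 : 1 ≤ Real.exp (K * (T - t)) :=
      Real.one_le_exp (mul_nonneg hK0 (by linarith [ht.2]))
    have h3 : Y * 1 ≤ Y * Real.exp (K * (T - t)) := by gcongr
    simp only [hD]
    linarith
  have hDderiv : ∀ t ∈ Icc 0 (T - 1), D (t + 1) ≤ 0 →
      0 ≤ Real.exp (-t) * (E' t - E t) + K * (Y * Real.exp (K * (T - t))) := fun t ht hD1 => by
    have h1 : Real.exp (-t) * -(κ * E (t + 1)) ≤ Real.exp (-t) * (E' t - E t) := by
      gcongr
      linarith [hineq t ht]
    have h2 : Real.exp (-t) = Real.exp 1 * Real.exp (-(t + 1)) := by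
      rw [← Real.exp_add]
      ring_nf
    have h3 : Real.exp (K * (T - (t + 1))) ≤ Real.exp (K * (T - t)) :=
      Real.exp_le_exp.2 (mul_le_mul_of_nonneg_left (by linarith) hK0)
    have h4 : K * (Real.exp (-(t + 1)) * E (t + 1)) ≤ K * (Y * Real.exp (K * (T - t))) := by
      refine mul_le_mul_of_nonneg_left ?_ hK0
      have : Y * Real.exp (K * (T - (t + 1))) ≤ Y * Real.exp (K * (T - t)) := by gcongr
      simp only [hD] at hD1
      linarith
    have h5 : Real.exp (-t) * -(κ * E (t + 1)) = -(K * (Real.exp (-(t + 1)) * E (t + 1))) := by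
      rw [h2, hK]
      ring
    linarith
  have hall : ∀ k : ℕ, ∀ t ∈ Icc 0 T, T - t ≤ k + 1 → D t ≤ 0 := fun k => by
    induction k with
    | zero => exact fun t ht htT => hend t ht (by push_cast at htT; linarith)
    | succ k ih =>
      intro t ht htT
      rcases le_total (T - 1) t with hc | hc
      · exact hend t ht hc
      have hmonoD : MonotoneOn D (Icc t (T - 1)) :=
        monotoneOn_of_hasDerivWithinAt_nonneg (convex_Icc _ _)
          (fun s _ => (hDd s).continuousAt.continuousWithinAt)
          (fun s _ => (hDd s).hasDerivWithinAt) fun s hs => by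
            rw [interior_Icc] at hs
            push_cast at htT
            exact hDderiv s ⟨by linarith [ht.1, hs.1], hs.2.le⟩
              (ih (s + 1) ⟨by linarith [ht.1, hs.1], by linarith [hs.2]⟩ (by linarith [hs.1]))
      exact (hmonoD ⟨le_rfl, hc⟩ ⟨hc, le_rfl⟩ hc).trans
        (hend (T - 1) ⟨by linarith [ht.1], by linarith⟩ le_rfl)
  obtain ⟨k, hk⟩ := exists_nat_ge (T - t)
  have hDt := hall k t ht (by linarith)
  simp only [hD] at hDt
  have h1 : Real.exp t * (Real.exp (-t) * E t) ≤ Real.exp t * (Y * Real.exp (K * (T - t))) :=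
    mul_le_mul_of_nonneg_left (by linarith) (Real.exp_pos _).le
  rw [← mul_assoc, ← Real.exp_add, add_neg_cancel, Real.exp_zero, one_mul] at h1
  refine h1.trans_eq ?_
  have h2 : Real.exp t * Real.exp (1 - T) * Real.exp (K * (T - t)) =
      Real.exp 1 * Real.exp (-(1 - K) * (T - t)) := by
    rw [← Real.exp_add, ← Real.exp_add, ← Real.exp_add]
    ring_nf
  rw [hY, ← h2]
  ring

namespace IsConformalCylinder

variable {n : ℕ} {f : ℝ × ℝ → EuclideanSpace ℝ (Fin n)} (hf : IsConformalCylinder f)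
include hf

theorem hasDerivAt_integral_circleEnergy (t : ℝ) :
    HasDerivAt (fun t => ∫ τ in -t..t, circleEnergy f τ)
      (circleEnergy f t + circleEnergy f (-t)) t := by
  have cG := hf.continuous_circleEnergy
  have hP : ∀ t, HasDerivAt (fun t => ∫ τ in (0:ℝ)..t, circleEnergy f τ) (circleEnergy f t) t :=
    fun t => intervalIntegral.integral_hasDerivAt_right (cG.intervalIntegrable _ _)
      (cG.stronglyMeasurableAtFilter _ _) cG.continuousAt
  have h := (hP t).sub ((hP (-t)).comp t (hasDerivAt_neg t))
  refine (h.congr_deriv (by ring)).congr_of_eventuallyEq (Eventually.of_forall fun s => ?_)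
  exact (intervalIntegral.integral_interval_sub_left (cG.intervalIntegrable _ _)
    (cG.intervalIntegrable _ _)).symm

theorem integral_circleEnergy_decay {T ε t : ℝ} (hε : 0 < ε) (hε' : ε ≤ 1 / 10)
    (hW : ∀ s ∈ Icc (-T) (T - 1),
      willmore f (Icc s (s + 1) ×ˢ Icc 0 (2 * π)) < ENNReal.ofReal (ε ^ 2))
    (ht : t ∈ Icc 0 T) :
    ∫ τ in -t..t, circleEnergy f τ ≤
      10000 * Real.exp (-(1 - 10000 * ε) * (T - t)) * ∫ τ in -T..T, circleEnergy f τ := by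
  have hT : 0 ≤ T := ht.1.trans ht.2
  have hET : 0 ≤ ∫ τ in -T..T, circleEnergy f τ :=
    intervalIntegral.integral_nonneg (by linarith) fun _ _ => circleEnergy_nonneg _
  have he : Real.exp 1 ≤ 3 := by linarith [Real.exp_one_lt_d9]
  refine (le_exp_mul_of_le_deriv_add_mul (κ := 3201 * ε) hf.hasDerivAt_integral_circleEnergy
    (by positivity)
    (fun s hs => hf.integral_circleEnergy_mono (by linarith [hs.2]) (by linarith [hs.1]) hs.2)
    hET (fun s hs => ?_) ht).trans ?_
  · have h1 := hf.integral_circleEnergy_le hs.1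
    have h2 := hf.integral_abs_inner_lap_le hε hε' hW hs.1 hs.2
    have h3 := hf.integral_circleEnergy_mono (by linarith : -(s + 1) ≤ -s)
      (by linarith [hs.1]) (by linarith : s ≤ s + 1)
    nlinarith
  · have h1 : 3201 * ε * Real.exp 1 ≤ 10000 * ε := by nlinarith
    have h2 : 0 ≤ T - t := by linarith [ht.2]
    gcongr
    linarith

end IsConformalCylinder

/-- Decay estimate (Proposition 2.3). -/
theorem decay_estimate (n : ℕ) (hn : 1 ≤ n) :
    ∃ ε₂ > (0:ℝ), ∃ C > (0:ℝ),
      ∀ T : ℝ, 3 ≤ T →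
        ∀ f : ℝ × ℝ → EuclideanSpace ℝ (Fin n),
          ContDiff ℝ (⊤ : ℕ∞) f →
          (∀ t θ : ℝ, f (t, θ + 2 * π) = f (t, θ)) →
          (∀ z, ‖pd1 f z‖ ^ 2 = ‖pd2 f z‖ ^ 2 ∧ ⟪pd1 f z, pd2 f z⟫ = 0) →
          (∀ z, fderiv ℝ f z = 0 → lap f z = 0) →
          ∀ ε : ℝ, 0 < ε → ε ≤ ε₂ →
            (∀ s ∈ Icc (-T) (T - 1),
                willmore f (Icc s (s + 1) ×ˢ Icc 0 (2 * π)) < ENNReal.ofReal (ε ^ 2)) →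
            ∀ t ∈ Icc (0:ℝ) T,
              ∫⁻ z in Icc (-t) t ×ˢ Icc 0 (2 * π), ENNReal.ofReal (gradSq f z)
                ≤ ENNReal.ofReal (C * Real.exp (-(1 - C * ε) * (T - t))) *
                  ∫⁻ z in Icc (-T) T ×ˢ Icc 0 (2 * π), ENNReal.ofReal (gradSq f z) := by
  refine ⟨1 / 10, by norm_num, 10000, by norm_num, ?_⟩
  intro T hT f hsmooth hper hconf hlap ε hε hε' hW t ht
  have hf : IsConformalCylinder f := ⟨hsmooth, hper, hconf, hlap⟩
  rw [hf.lintegral_gradSq (by linarith [ht.1]), hf.lintegral_gradSq (by linarith),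
    ← ENNReal.ofReal_mul (by positivity)]
  exact ENNReal.ofReal_le_ofReal (hf.integral_circleEnergy_decay hε hε' hW ht)
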